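/- Let d ≥ 1, s ∈ (0,1), p ∈ (1,∞), and let Ω ⊂ ℝ^d be an open set with 0 ∈ Ω. Let f ∈ L^∞(Ω) satisfy |f(x)| = O(|x|^n) as |x| → 0 for every n ∈ ℕ, and let V : Ω × ℝ → ℝ be such that for some ε₀ > 0 and n₀ ∈ ℕ the function (x,t) ↦ |x|^{n₀} |t|^{−ε₀} V(x,t) is essentially bounded. Assume u ∈ L^{p−1}_{sp}(ℝ^d) is locally β-Hölder continuous in Ω for some β with sp/(p−1) < β ≤ 1, is a strong solution of (−Δ_p)^s u − V(·,u) = f in Ω, and that for every i ∈ {1,…,d} the series Σ_{k=1}^∞ m_{i,k}^{−1/(2k)} diverges to +∞. Then for every multiindex α ∈ ℕ^d the function y ↦ J_p(u(y)) |y|^{−d−sp} y^α |y|^{−2|α|} is absolutely integrable on ℝ^d and ∫_{ℝ^d} J_p(u(y)) |y|^{−d−sp} · y^α |y|^{−2|α|} dy = 0, where y^α := y_1^{α_1}⋯y_d^{α_d} and |α| = α_1+⋯+α_d. -/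

import Mathlib

open MeasureTheory Filter Asymptotics Metric Set NNReal ENNReal

noncomputable section

/-- Euclidean space `ℝ^d`. -/
abbrev Ed (d : ℕ) := EuclideanSpace ℝ (Fin d)

/-- `J_p(t) = |t|^{p-2} t`. -/
def Jp (p t : ℝ) : ℝ := |t| ^ (p - 2) * t

/-- The principal value defining the fractional `p`-Laplacian of `u` at `x` exists and
equals `L`. -/
def fracPLapAt (d : ℕ) (s p : ℝ) (u : Ed d → ℝ) (x : Ed d) (L : ℝ) : Prop :=
  Tendsto (fun δ : ℝ =>
      ∫ y in {y : Ed d | δ < ‖x - y‖}, Jp p (u x - u y) / ‖x - y‖ ^ ((d : ℝ) + s * p))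
    (nhdsWithin 0 (Ioi 0)) (nhds L)

/-- Membership in the tail space `L^{p-1}_{sp}(ℝ^d)`. -/
def memTail (d : ℕ) (s p : ℝ) (u : Ed d → ℝ) : Prop :=
  Measurable u ∧
    Integrable (fun x : Ed d => |u x| ^ (p - 1) / (1 + ‖x‖) ^ ((d : ℝ) + s * p))

/-- The moments `m_{i,k} = ∫ x_i^{2k} |x|^{-4k} |u(x)|^{p-1} |x|^{-d-sp} dx ∈ [0,∞]`. -/
def mik (d : ℕ) (s p : ℝ) (u : Ed d → ℝ) (i : Fin d) (k : ℕ) : ℝ≥0∞ :=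
  ∫⁻ x : Ed d, ENNReal.ofReal
    ((x i ^ (2 * k) / ‖x‖ ^ (4 * k)) * (|u x| ^ (p - 1) / ‖x‖ ^ ((d : ℝ) + s * p)))

/-- The Carleman-type condition: for every `i` the series `∑_{k≥1} m_{i,k}^{-1/(2k)}`
diverges to `+∞` (with conventions `1/0 = ∞`, `1/∞ = 0`). -/
def carleman (d : ℕ) (s p : ℝ) (u : Ed d → ℝ) : Prop :=
  ∀ i : Fin d, ∑' k : ℕ, (mik d s p u i (k + 1) ^ ((1 : ℝ) / (2 * ((k : ℝ) + 1))))⁻¹ = ⊤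


/-- formal Laplacian -/
def laplP (d : ℕ) : MvPolynomial (Fin d) ℝ →ₗ[ℝ] MvPolynomial (Fin d) ℝ :=
  ∑ i, (MvPolynomial.pderiv i).toLinearMap ∘ₗ (MvPolynomial.pderiv i).toLinearMap

def rrP (d : ℕ) : MvPolynomial (Fin d) ℝ := ∑ i, MvPolynomial.X i ^ 2

lemma laplP_apply (d : ℕ) (A : MvPolynomial (Fin d) ℝ) :
    laplP d A = ∑ i, MvPolynomial.pderiv i (MvPolynomial.pderiv i A) := by
  simp [laplP]

lemma pderiv_rrP (d : ℕ) (i : Fin d) :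
    MvPolynomial.pderiv i (rrP d) = 2 * MvPolynomial.X i := by
  classical
  simp only [rrP, map_sum]
  rw [Finset.sum_eq_single i]
  · simp [pow_two]; ring
  · intro j _ hj
    simp [pow_two, MvPolynomial.pderiv_X_of_ne hj]
  · simp

lemma rrP_hom (d : ℕ) : (rrP d).IsHomogeneous 2 := by
  unfold rrP
  apply MvPolynomial.IsHomogeneous.sum
  intro i _
  simpa using (MvPolynomial.isHomogeneous_X ℝ i).pow 2

lemma laplP_rr_mul (d m : ℕ) (A : MvPolynomial (Fin d) ℝ) (hA : A.IsHomogeneous m) :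
    laplP d (rrP d * A) = rrP d * laplP d A + (2 * (d : ℝ) + 4 * m) • A := by
  have hE := hA.sum_X_mul_pderiv
  rw [laplP_apply, laplP_apply]
  have : ∀ i, MvPolynomial.pderiv i (MvPolynomial.pderiv i (rrP d * A))
      = 2 * A + 4 * (MvPolynomial.X i * MvPolynomial.pderiv i A)
        + rrP d * MvPolynomial.pderiv i (MvPolynomial.pderiv i A) := by
    intro i
    have h2 : MvPolynomial.pderiv i (2 : MvPolynomial (Fin d) ℝ) = 0 := by
      rw [show (2 : MvPolynomial (Fin d) ℝ) = MvPolynomial.C 2 from (map_ofNat _ 2).symm,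
        MvPolynomial.pderiv_C]
    simp only [Derivation.leibniz, pderiv_rrP, map_add, smul_eq_mul, MvPolynomial.pderiv_X_self, h2]
    ring
  simp only [this, Finset.sum_add_distrib, ← Finset.mul_sum, hE]
  simp only [Finset.sum_const, Finset.card_univ, Fintype.card_fin, nsmul_eq_mul, MvPolynomial.smul_eq_C_mul,
    map_add, map_mul, map_natCast, map_ofNat]
  ring

lemma laplP_rr_pow (d m : ℕ) (A : MvPolynomial (Fin d) ℝ) (hA : A.IsHomogeneous m) (j : ℕ) :
    laplP d (rrP d ^ (j+1) * A) = rrP d ^ (j+1) * laplP d A +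
      (2 * ((j:ℝ)+1) * (2 * (j+1) + d - 2 + 2 * m)) • (rrP d ^ j * A) := by
  induction j with
  | zero =>
    have := laplP_rr_mul d m A hA
    simp only [zero_add, pow_one, this, pow_zero, one_mul]
    congr 2; push_cast; ring
  | succ j ih =>
    have h1 : (rrP d ^ (j+1) * A).IsHomogeneous (2 * (j+1) + m) := ((rrP_hom d).pow (j+1)).mul hA
    have := laplP_rr_mul d _ _ h1
    rw [show rrP d ^ (j+1+1) * A = rrP d * (rrP d ^ (j+1) * A) by ring, this, ih]
    simp only [MvPolynomial.smul_eq_C_mul]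
    push_cast
    simp only [map_add, map_mul, map_natCast, map_ofNat, map_sub, map_one]
    ring

lemma laplP_hom (d m : ℕ) (A : MvPolynomial (Fin d) ℝ) (hA : A.IsHomogeneous m) :
    (laplP d A).IsHomogeneous (m - 2) := by
  rw [laplP_apply]
  apply MvPolynomial.IsHomogeneous.sum
  intro i _
  exact hA.pderiv.pderiv

lemma laplP_low (d m : ℕ) (hm : m < 2) (A : MvPolynomial (Fin d) ℝ) (hA : A.IsHomogeneous m) :
    laplP d A = 0 := by
  rw [laplP_apply]
  apply Finset.sum_eq_zero
  intro i _
  have h : (MvPolynomial.pderiv i A).IsHomogeneous 0 := by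
    have := hA.pderiv (i := i)
    rwa [show m - 1 = 0 by omega] at this
  rw [← MvPolynomial.totalDegree_zero_iff_isHomogeneous, MvPolynomial.totalDegree_eq_zero_iff_eq_C] at h
  rw [h, MvPolynomial.pderiv_C]

lemma laplP_iter_hom (d m : ℕ) (A : MvPolynomial (Fin d) ℝ) (hA : A.IsHomogeneous m) (j : ℕ) :
    ((laplP d)^[j] A).IsHomogeneous (m - 2 * j) := by
  induction j with
  | zero => simpa using hA
  | succ j ih =>
    rw [Function.iterate_succ_apply']
    have := laplP_hom d _ _ ih
    rwa [show m - 2 * j - 2 = m - 2 * (j+1) by omega] at this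

/-- coefficients -/
def acf (μ : ℝ) : ℕ → ℝ
  | 0 => 1
  | (j+1) => - acf μ j / (4 * ((j:ℝ)+1) * (μ - j - 1))

lemma acf_shift (μ : ℝ) (j : ℕ) (h : ∀ i : ℕ, i ≤ j → μ - i - 1 ≠ 0) :
    acf μ j / (μ - j - 1) = acf (μ - 1) j / (μ - 1) := by
  induction j with
  | zero => simp [acf]
  | succ j ih =>
    have ih := ih (fun i hi => h i (by omega))
    have h1 := h j (by omega)
    have h2 := h (j+1) le_rfl
    push_cast at h2
    have h3 := h 0 (by omega)
    have h4 : (j:ℝ)+1 ≠ 0 := by positivity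
    have h5 : μ - 1 - j - 1 ≠ 0 := by intro h; apply h2; linarith
    have h6 : μ - 1 ≠ 0 := by simpa using h3
    have e : acf μ j = acf (μ - 1) j / (μ - 1) * (μ - j - 1) := by rw [← ih]; field_simp
    simp only [acf]
    rw [e]
    push_cast
    have h7 : μ - (j+1) - 1 ≠ 0 := h2
    rw [show μ - 1 - j - 1 = μ - (j+1) - 1 by ring]
    field_simp

lemma key_poly (d : ℕ) (N : ℕ) : ∀ (lam : ℝ) (_ : 0 < lam) (_ : (d:ℝ) - 2 < 2 * lam)
    (A : MvPolynomial (Fin d) ℝ) (_ : A.IsHomogeneous N)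
    (_ : ∑ j ∈ Finset.range (N/2+1), acf (lam + N) j • (rrP d ^ j * (laplP d)^[j] A) = 0),
    A = 0 := by
  induction N using Nat.strong_induction_on with
  | _ N IH =>
  intro lam hl hd A hA h
  by_cases hN : N < 2
  · have : N / 2 = 0 := by omega
    simpa [this, acf] using h
  obtain ⟨n, rfl⟩ : ∃ n, N = n + 2 := ⟨N - 2, by omega⟩
  have hL : laplP d A = 0 := by
    apply IH n (by omega) (lam + 1) (by linarith) (by linarith) _ (laplP_hom d _ _ hA)
    have h2 := congrArg (laplP d) h
    rw [map_zero, map_sum] at h2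
    simp only [map_smul] at h2
    rw [show (n+2)/2+1 = (n/2+1)+1 by omega, Finset.sum_range_succ'] at h2
    set K := n/2+1 with hK
    have e1 : ∀ j : ℕ, laplP d (rrP d ^ (j+1) * (laplP d)^[j+1] A) =
        rrP d ^ (j+1) * (laplP d)^[j+1] (laplP d A) +
        (2 * ((j:ℝ)+1) * (2 * (j+1) + d - 2 + 2 * ((n + 2 - 2 * (j+1) : ℕ):ℝ))) •
          (rrP d ^ j * (laplP d)^[j] (laplP d A)) := by
      intro j
      rw [laplP_rr_pow d _ _ (laplP_iter_hom d _ A hA (j+1))]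
      rw [← Function.iterate_succ_apply' (laplP d), Function.iterate_succ_apply,
        Function.iterate_succ_apply (laplP d) j A]
    simp only [e1, smul_add, Finset.sum_add_distrib] at h2
    have top : (laplP d)^[K] (laplP d A) = 0 := by
      rw [← Function.iterate_succ_apply, Function.iterate_succ_apply']
      apply laplP_low d _ _ _ (laplP_iter_hom d _ A hA K)
      omega
    have e2 : ∑ j ∈ Finset.range K, acf (lam + ((n+2:ℕ):ℝ)) (j+1) •
          (rrP d ^ (j+1) * (laplP d)^[j+1] (laplP d A)) +
        acf (lam + ((n+2:ℕ):ℝ)) 0 • laplP d (rrP d ^ 0 * (laplP d)^[0] A)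
        = ∑ j ∈ Finset.range K, acf (lam + ((n+2:ℕ):ℝ)) j •
          (rrP d ^ j * (laplP d)^[j] (laplP d A)) := by
      have := Finset.sum_range_succ' (fun j => acf (lam + ((n+2:ℕ):ℝ)) j •
          (rrP d ^ j * (laplP d)^[j] (laplP d A))) K
      rw [Finset.sum_range_succ, top] at this
      simp only [mul_zero, smul_zero, add_zero] at this
      rw [this]; simp
    rw [add_right_comm, e2, ← Finset.sum_add_distrib] at h2
    have hc : (2 * lam + 2 - d) / 2 / (lam + (n:ℝ) + 1) ≠ 0 := by
      have : 0 < (2 * lam + 2 - d) / 2 / (lam + (n:ℝ) + 1) := by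
        apply div_pos
        · linarith
        · positivity
      exact this.ne'
    have h3 : ((2 * lam + 2 - d) / 2 / (lam + (n:ℝ) + 1)) • ∑ j ∈ Finset.range K,
        acf (lam + 1 + n) j • (rrP d ^ j * (laplP d)^[j] (laplP d A)) = 0 := by
      rw [← h2, Finset.smul_sum]
      apply Finset.sum_congr rfl
      intro j hj
      have hj' : 2 * j ≤ n := by
        have := Finset.mem_range.1 hj
        omega
      rw [smul_smul, smul_smul, ← add_smul]
      congr 1
      have hcast : ((n + 2 - 2 * (j+1) : ℕ):ℝ) = n - 2 * j := by
        rw [Nat.cast_sub (by omega)]; push_cast; ring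
      have hjr : 2 * (j:ℝ) ≤ n := by exact_mod_cast hj'
      have hpos : 0 < lam + (n:ℝ) + 2 - j - 1 := by
        have : (0:ℝ) ≤ j := by positivity
        linarith
      have hs := acf_shift (lam + ((n+2:ℕ):ℝ)) j (by
        intro i hi
        have : (i:ℝ) ≤ j := by exact_mod_cast hi
        have h0 : (0:ℝ) ≤ j := by positivity
        push_cast
        apply ne_of_gt
        linarith)
      rw [hcast]
      simp only [acf]
      push_cast at hs ⊢
      rw [show lam + ((n:ℝ)+2) - 1 = lam + 1 + n by ring] at hs
      have hp2 : lam + ((n:ℝ)+2) - j - 1 ≠ 0 := by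
        apply ne_of_gt; linarith
      have hp3 : lam + 1 + (n:ℝ) ≠ 0 := by positivity
      have hp4 : (j:ℝ)+1 ≠ 0 := by positivity
      rw [div_eq_div_iff hp2 hp3] at hs
      have hs' : acf (lam + 1 + n) j = acf (lam + (n+2)) j * (lam + 1 + n) / (lam + (n+2) - j - 1) := by
        rw [hs]; field_simp
      rw [hs']
      rw [show lam + (n:ℝ) + 1 = lam + 1 + n by ring]
      field_simp
      ring
    exact (smul_eq_zero.1 h3).resolve_left hc
  rw [Finset.sum_eq_single 0] at h
  · simpa [acf] using h
  · intro j _ hj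
    obtain ⟨k, rfl⟩ := Nat.exists_eq_succ_of_ne_zero hj
    rw [Nat.succ_eq_add_one, Function.iterate_succ_apply, hL]
    simp
  · simp

/-- polynomial in `x` representing `ℓ(φ (x·z)^N)` -/
def BP (d : ℕ) (l : MvPolynomial (Fin d) ℝ →ₗ[ℝ] ℝ) :
    ℕ → MvPolynomial (Fin d) ℝ → MvPolynomial (Fin d) ℝ
  | 0, φ => MvPolynomial.C (l φ)
  | (N+1), φ => ∑ i, MvPolynomial.X i * BP d l N (φ * MvPolynomial.X i)

lemma BP_add (d : ℕ) (l : MvPolynomial (Fin d) ℝ →ₗ[ℝ] ℝ) (N : ℕ) : ∀ φ ψ,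
    BP d l N (φ + ψ) = BP d l N φ + BP d l N ψ := by
  induction N with
  | zero => intro φ ψ; simp [BP]
  | succ N ih => intro φ ψ; simp [BP, add_mul, ih, mul_add, Finset.sum_add_distrib]

lemma BP_zero (d : ℕ) (l : MvPolynomial (Fin d) ℝ →ₗ[ℝ] ℝ) (N : ℕ) : BP d l N 0 = 0 := by
  have := BP_add d l N 0 0
  simpa using this

lemma BP_sum (d : ℕ) (l : MvPolynomial (Fin d) ℝ →ₗ[ℝ] ℝ) (N : ℕ) (s : Finset (Fin d))
    (g : Fin d → MvPolynomial (Fin d) ℝ) :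
    BP d l N (∑ i ∈ s, g i) = ∑ i ∈ s, BP d l N (g i) := by
  classical
  induction s using Finset.induction_on with
  | empty => simp [BP_zero]
  | insert a s ha ih => rw [Finset.sum_insert ha, Finset.sum_insert ha, BP_add, ih]

lemma BP_hom (d : ℕ) (l : MvPolynomial (Fin d) ℝ →ₗ[ℝ] ℝ) (N : ℕ) : ∀ φ,
    (BP d l N φ).IsHomogeneous N := by
  induction N with
  | zero => intro φ; exact MvPolynomial.isHomogeneous_C _ _
  | succ N ih =>
    intro φ
    apply MvPolynomial.IsHomogeneous.sum
    intro i _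
    rw [add_comm]
    exact (MvPolynomial.isHomogeneous_X ℝ i).mul (ih _)

lemma BP_eval (d : ℕ) (l : MvPolynomial (Fin d) ℝ →ₗ[ℝ] ℝ) (x : Fin d → ℝ) (N : ℕ) : ∀ φ,
    MvPolynomial.eval x (BP d l N φ) =
      l (φ * (∑ i, MvPolynomial.C (x i) * MvPolynomial.X i) ^ N) := by
  induction N with
  | zero => intro φ; simp [BP]
  | succ N ih =>
    intro φ
    simp only [BP, map_sum, map_mul, MvPolynomial.eval_X, ih]
    rw [pow_succ', ← mul_assoc, Finset.mul_sum, Finset.sum_mul, map_sum]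
    apply Finset.sum_congr rfl
    intro i _
    rw [← smul_eq_mul, ← map_smul]
    congr 1
    rw [MvPolynomial.smul_eq_C_mul]
    ring

lemma BP_pderiv (d : ℕ) (l : MvPolynomial (Fin d) ℝ →ₗ[ℝ] ℝ) (i : Fin d) (N : ℕ) : ∀ φ,
    MvPolynomial.pderiv i (BP d l (N+1) φ) =
      ((N:ℝ)+1) • BP d l N (φ * MvPolynomial.X i) := by
  classical
  induction N with
  | zero =>
    intro φ
    simp only [BP, map_sum, Derivation.leibniz, MvPolynomial.pderiv_C]
    rw [Finset.sum_eq_single i]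
    · simp
    · intro j _ hj; simp [MvPolynomial.pderiv_X_of_ne hj]
    · simp
  | succ N ih =>
    intro φ
    rw [BP]
    simp only [map_sum, Derivation.leibniz, ih, Finset.sum_add_distrib]
    rw [Finset.sum_eq_single (a := i) (f := fun j => BP d l (N+1) (φ * MvPolynomial.X j) • MvPolynomial.pderiv i (MvPolynomial.X j : MvPolynomial (Fin d) ℝ))]
    · rw [BP]
      simp only [MvPolynomial.pderiv_X_self, MvPolynomial.smul_eq_C_mul, smul_eq_mul]
      simp only [mul_right_comm φ, Finset.mul_sum, mul_one, ← Finset.sum_add_distrib]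
      apply Finset.sum_congr rfl
      intro j _
      push_cast
      simp only [map_add, map_natCast, map_one]
      ring
    · intro j _ hj; simp [MvPolynomial.pderiv_X_of_ne hj]
    · simp

lemma BP_lapl (d : ℕ) (l : MvPolynomial (Fin d) ℝ →ₗ[ℝ] ℝ) (N : ℕ) (φ) :
    laplP d (BP d l (N+2) φ) = (((N:ℝ)+2) * (N+1)) • BP d l N (φ * rrP d) := by
  rw [laplP_apply, rrP, Finset.mul_sum, BP_sum, Finset.smul_sum]
  apply Finset.sum_congr rfl
  intro i _
  rw [show N + 2 = (N+1)+1 from rfl, BP_pderiv, Derivation.map_smul, BP_pderiv, smul_smul]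
  congr 1
  · push_cast; ring
  · congr 1; ring

lemma BP_iter (d : ℕ) (l : MvPolynomial (Fin d) ℝ →ₗ[ℝ] ℝ) (N j : ℕ) (hj : 2 * j ≤ N) (φ) :
    (laplP d)^[j] (BP d l N φ) = ((N.factorial : ℝ) / (N - 2 * j).factorial) •
      BP d l (N - 2 * j) (φ * rrP d ^ j) := by
  induction j with
  | zero => simp [div_self (show (N.factorial:ℝ) ≠ 0 by positivity)]
  | succ j ih =>
    rw [Function.iterate_succ_apply', ih (by omega), map_smul]
    obtain ⟨m, hm⟩ : ∃ m, N - 2 * j = m + 2 := ⟨N - 2*j - 2, by omega⟩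
    rw [hm, show N - 2 * (j+1) = m by omega, BP_lapl, smul_smul]
    congr 1
    · rw [Nat.factorial_succ, Nat.factorial_succ]
      have : (m.factorial:ℝ) ≠ 0 := by positivity
      push_cast
      field_simp
      ring
    · congr 1; ring

lemma BP_moment (d : ℕ) (l : MvPolynomial (Fin d) ℝ →ₗ[ℝ] ℝ) (s : Multiset (Fin d)) : ∀ φ,
    BP d l (Multiset.card s) φ = 0 → l (φ * (s.map MvPolynomial.X).prod) = 0 := by
  induction s using Multiset.induction_on with
  | empty => intro φ h; simpa [BP] using h
  | cons a s ih =>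
    intro φ h
    rw [Multiset.card_cons] at h
    have := BP_pderiv d l a (Multiset.card s) φ
    rw [h, map_zero] at this
    have h2 := (smul_eq_zero.1 this.symm).resolve_left (by positivity)
    have := ih _ h2
    rw [Multiset.map_cons, Multiset.prod_cons, ← mul_assoc]
    exact this

lemma choose_rec (v : ℝ) (k : ℕ) :
    ((k:ℝ)+1) * Ring.choose v (k+1) = (v - k) * Ring.choose v k := by
  have h := Ring.choose_smul_choose v (Nat.le_succ k)
  have h1 : (k+1).choose k = k + 1 := by simp
  rw [Nat.succ_eq_add_one, h1, show k + 1 - k = 1 by omega, Ring.choose_one_right] at h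
  rw [nsmul_eq_mul] at h
  push_cast at h
  rw [h]; ring

lemma choose_ne (v : ℝ) (hv : v < 0) (k : ℕ) : Ring.choose v k ≠ 0 := by
  induction k with
  | zero => simp
  | succ k ih =>
    intro h
    have := choose_rec v k
    rw [h, mul_zero] at this
    have h2 : v - k ≠ 0 := by
      have : (0:ℝ) ≤ k := by positivity
      apply ne_of_lt; linarith
    exact (mul_ne_zero h2 ih) this.symm

lemma coef_eq (lam : ℝ) (hl : 0 < lam) (N j : ℕ) (hj : 2 * j ≤ N) :
    Ring.choose (-lam) (N - j) * ((N-j).choose j : ℝ) * (-2) ^ (N - 2 * j) * (N - 2 * j).factorial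
    = Ring.choose (-lam) N * (-2) ^ N * N.factorial * acf (lam + N) j := by
  induction j with
  | zero => simp [acf]
  | succ j ih =>
    have ih := ih (by omega)
    obtain ⟨m, hm⟩ : ∃ m, N = m + 2 * j + 2 := ⟨N - 2*j - 2, by omega⟩
    simp only [acf]
    have e : Ring.choose (-lam) N * (-2) ^ N * N.factorial *
        (-acf (lam + N) j / (4 * (j+1) * (lam + N - j - 1)))
        = (Ring.choose (-lam) N * (-2) ^ N * N.factorial * acf (lam + N) j) *
          (-1 / (4 * (j+1) * (lam + N - j - 1))) := by ring
    rw [e, ← ih]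
    subst hm
    rw [show m + 2 * j + 2 - j = (m + j + 1) + 1 by omega,
      show m + 2 * j + 2 - 2 * j = m + 2 by omega,
      show m + 2 * j + 2 - (j+1) = m + j + 1 by omega,
      show m + 2 * j + 2 - 2 * (j+1) = m by omega]
    have hr := choose_rec (-lam) (m+j+1)
    have hb : Ring.choose (-lam) (m+j+1+1) = (-lam - (m+j+1:ℕ)) / ((m+j+1:ℕ)+1) * Ring.choose (-lam) (m+j+1) := by
      rw [div_mul_eq_mul_div, ← hr]; field_simp
    rw [hb]
    -- choose numbers
    have hc1 : ((m+j+1+1).choose j : ℝ) * (j.factorial * (m+2).factorial) = (m+j+1+1).factorial := by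
      have := Nat.choose_mul_factorial_mul_factorial (show j ≤ m+j+1+1 by omega)
      rw [show m+j+1+1 - j = m+2 by omega] at this
      rw [← mul_assoc]; exact_mod_cast this
    have hc2 : ((m+j+1).choose (j+1) : ℝ) * ((j+1).factorial * m.factorial) = (m+j+1).factorial := by
      have := Nat.choose_mul_factorial_mul_factorial (show j+1 ≤ m+j+1 by omega)
      rw [show m+j+1 - (j+1) = m by omega] at this
      rw [← mul_assoc]; exact_mod_cast this
    have hf1 : (m.factorial:ℝ) ≠ 0 := by positivity
    have hf2 : (j.factorial:ℝ) ≠ 0 := by positivity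
    have hf3 : ((m+2).factorial:ℝ) ≠ 0 := by positivity
    have hf4 : ((j+1).factorial:ℝ) ≠ 0 := by positivity
    have hc1' := eq_div_of_mul_eq (mul_ne_zero hf2 hf3) hc1
    have hc2' := eq_div_of_mul_eq (mul_ne_zero hf4 hf1) hc2
    rw [hc1', hc2']
    rw [Nat.factorial_succ (m+j+1), Nat.factorial_succ j]
    have hq : lam + ((m + 2 * j + 2:ℕ):ℝ) - j - 1 ≠ 0 := by
      push_cast
      have : (0:ℝ) < lam + (m+2*j+2) - j - 1 := by
        have : (0:ℝ) ≤ m := by positivity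
        have : (0:ℝ) ≤ j := by positivity
        linarith
      exact this.ne'
    have hq2 : (j:ℝ)+1 ≠ 0 := by positivity
    have hq3 : (m:ℝ)+j+1+1 ≠ 0 := by positivity
    push_cast at hq ⊢
    have hq5 : lam + ((m:ℝ) + 2 * j + 2) - j - 1 = lam + m + j + 1 := by ring
    rw [hq5] at hq ⊢
    rw [pow_add]
    field_simp
    ring

/-- The algebraic heart. -/
lemma alg_main (d : ℕ) (l : MvPolynomial (Fin d) ℝ →ₗ[ℝ] ℝ) (lam : ℝ) (hl : 0 < lam)
    (hd : (d:ℝ) - 2 < 2 * lam) (N : ℕ)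
    (h : ∀ x : Fin d → ℝ, ∑ j ∈ Finset.range (N/2+1),
      Ring.choose (-lam) (N - j) * ((N-j).choose j : ℝ) * (-2) ^ (N - 2 * j) *
        ((∑ i, x i ^ 2) ^ j *
        l ((∑ i, MvPolynomial.C (x i) * MvPolynomial.X i) ^ (N - 2 * j) * rrP d ^ j)) = 0)
    (s : Multiset (Fin d)) (hs : Multiset.card s = N) : l ((s.map MvPolynomial.X).prod) = 0 := by
  have hB : BP d l N 1 = 0 := by
    apply key_poly d N lam hl hd _ (BP_hom d l N 1)
    have hc : Ring.choose (-lam) N * (-2) ^ N ≠ 0 :=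
      mul_ne_zero (choose_ne _ (by linarith) _) (pow_ne_zero _ (by norm_num))
    suffices hsuff : (Ring.choose (-lam) N * (-2) ^ N) • ∑ j ∈ Finset.range (N/2+1),
        acf (lam + N) j • (rrP d ^ j * (laplP d)^[j] (BP d l N 1)) = 0 from
      (smul_eq_zero.1 hsuff).resolve_left hc
    apply MvPolynomial.funext
    intro x
    rw [Finset.smul_sum, map_sum, map_zero, ← h x]
    apply Finset.sum_congr rfl
    intro j hj
    have hj' : 2 * j ≤ N := by have := Finset.mem_range.1 hj; omega
    rw [BP_iter d l N j hj']
    simp only [MvPolynomial.smul_eval, map_mul, map_pow, BP_eval, one_mul]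
    have hce := coef_eq lam hl N j hj'
    have hf : ((N - 2 * j).factorial : ℝ) ≠ 0 := by positivity
    have hr : MvPolynomial.eval x (rrP d) = ∑ i, x i ^ 2 := by simp [rrP]
    rw [hr]
    rw [mul_comm (rrP d ^ j)]
    have : Ring.choose (-lam) (N - j) * ((N-j).choose j : ℝ) * (-2) ^ (N - 2 * j)
      = Ring.choose (-lam) N * (-2) ^ N * N.factorial * acf (lam + N) j / (N - 2 * j).factorial := by
      rw [← hce]; field_simp
    rw [this]
    ring
  have := BP_moment d l s 1 (by rw [hs]; exact hB)
  simpa using this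

lemma poly_small (M : ℕ) : ∀ (P : Polynomial ℝ) (C t0 : ℝ) (_ : 0 < t0)
    (_ : ∀ t, 0 < t → t < t0 → |P.eval t| ≤ C * t ^ M), ∀ N < M, P.coeff N = 0 := by
  induction M with
  | zero => intro P C t0 _ _ N hN; omega
  | succ M ih =>
    intro P C t0 ht0 h N hN
    have hP0 : P.coeff 0 = 0 := by
      rw [Polynomial.coeff_zero_eq_eval_zero]
      have h1 : Tendsto (fun t => |P.eval t|) (nhdsWithin 0 (Ioi 0)) (nhds |P.eval 0|) :=
        ((P.continuous.abs).tendsto 0).mono_left nhdsWithin_le_nhds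
      have h2 : Tendsto (fun t : ℝ => C * t ^ (M+1)) (nhdsWithin 0 (Ioi 0)) (nhds (C * 0 ^ (M+1))) :=
        ((by fun_prop : Continuous (fun t : ℝ => C * t ^ (M+1))).tendsto 0).mono_left nhdsWithin_le_nhds
      have h3 := le_of_tendsto_of_tendsto h1 h2 (by
        filter_upwards [Ioo_mem_nhdsGT ht0] with t ht
        exact h t ht.1 ht.2)
      simp at h3
      exact h3
    have hd : P = Polynomial.X * P.divX := by
      have := Polynomial.X_mul_divX_add P
      rw [hP0] at this
      simpa using this.symm
    rcases N with _ | N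
    · exact hP0
    · rw [← Polynomial.coeff_divX]
      apply ih P.divX C t0 ht0 _ N (by omega)
      intro t ht1 ht2
      have := h t ht1 ht2
      rw [hd] at this
      simp only [Polynomial.eval_mul, Polynomial.eval_X, abs_mul, abs_of_pos ht1] at this
      rw [pow_succ] at this
      have h4 : t * |P.divX.eval t| ≤ t * (C * t ^ M) := by nlinarith
      exact le_of_mul_le_mul_left h4 ht1

/-- the polynomial `-2 x·z + |x|^2 |z|^2` in `z`. -/
def WP (d : ℕ) (x : Fin d → ℝ) : MvPolynomial (Fin d) ℝ :=
  MvPolynomial.C (-2) * (∑ i, MvPolynomial.C (x i) * MvPolynomial.X i) +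
    MvPolynomial.C (∑ i, x i ^ 2) * rrP d

lemma WP_pow (d : ℕ) (l : MvPolynomial (Fin d) ℝ →ₗ[ℝ] ℝ) (x : Fin d → ℝ) (t : ℝ) (k : ℕ) :
    l (WP d (fun i => t * x i) ^ k) = ∑ j ∈ Finset.range (k+1),
      ((k.choose j : ℝ) * (-2) ^ (k - j) * ((∑ i, x i ^ 2) ^ j *
        l ((∑ i, MvPolynomial.C (x i) * MvPolynomial.X i) ^ (k - j) * rrP d ^ j))) * t ^ (k + j) := by
  have e : WP d (fun i => t * x i) =
      MvPolynomial.C (t ^ 2 * ∑ i, x i ^ 2) * rrP d +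
      MvPolynomial.C (-2 * t) * (∑ i, MvPolynomial.C (x i) * MvPolynomial.X i) := by
    unfold WP
    rw [add_comm]
    congr 1
    · congr 2; rw [Finset.mul_sum]; apply Finset.sum_congr rfl; intro i _; ring
    · rw [Finset.mul_sum, Finset.mul_sum]; apply Finset.sum_congr rfl; intro i _
      simp only [MvPolynomial.C_mul]; ring
  rw [e, add_pow, map_sum]
  apply Finset.sum_congr rfl
  intro j hj
  have hj' : j ≤ k := by have := Finset.mem_range.1 hj; omega
  set S := ∑ i, MvPolynomial.C (x i) * MvPolynomial.X i with hS
  have e2 : (MvPolynomial.C (t ^ 2 * ∑ i, x i ^ 2) * rrP d) ^ j *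
      (MvPolynomial.C (-2 * t) * S) ^ (k - j) * (k.choose j : MvPolynomial (Fin d) ℝ)
      = ((t ^ 2 * ∑ i, x i ^ 2) ^ j * (-2 * t) ^ (k - j) * (k.choose j : ℝ)) •
        (S ^ (k - j) * rrP d ^ j) := by
    rw [MvPolynomial.smul_eq_C_mul]
    simp only [MvPolynomial.C_mul, MvPolynomial.C_pow, mul_pow, map_natCast]
    ring
  rw [e2, map_smul, smul_eq_mul]
  have e3 : t ^ (k + j) = t ^ (2 * j) * t ^ (k - j) := by
    rw [← pow_add]; congr 1; omega
  rw [e3, pow_mul]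
  ring

lemma alg_main2 (d : ℕ) (l : MvPolynomial (Fin d) ℝ →ₗ[ℝ] ℝ) (lam : ℝ) (hl : 0 < lam)
    (hd : (d:ℝ) - 2 < 2 * lam)
    (h : ∀ (x : Fin d → ℝ) (M : ℕ), ∃ C t0 : ℝ, 0 < t0 ∧ ∀ t, 0 < t → t < t0 →
      |l (∑ k ∈ Finset.range M, Ring.choose (-lam) k • WP d (fun i => t * x i) ^ k)| ≤ C * t ^ M)
    (s : Multiset (Fin d)) : l ((s.map MvPolynomial.X).prod) = 0 := by
  apply alg_main d l lam hl hd (Multiset.card s) _ s rfl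
  intro x
  set N := Multiset.card s
  obtain ⟨C, t0, ht0, hC⟩ := h x (N+1)
  set cf : ℕ → ℕ → ℝ := fun k j => Ring.choose (-lam) k *
    ((k.choose j : ℝ) * (-2) ^ (k - j) * ((∑ i, x i ^ 2) ^ j *
        l ((∑ i, MvPolynomial.C (x i) * MvPolynomial.X i) ^ (k - j) * rrP d ^ j))) with hcf
  set P : Polynomial ℝ := ∑ k ∈ Finset.range (N+1), ∑ j ∈ Finset.range (k+1),
    Polynomial.monomial (k+j) (cf k j) with hP
  have hPe : ∀ t, P.eval t =
      l (∑ k ∈ Finset.range (N+1), Ring.choose (-lam) k • WP d (fun i => t * x i) ^ k) := by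
    intro t
    rw [map_sum]
    simp only [map_smul, WP_pow, hP, Polynomial.eval_finsetSum, Polynomial.eval_monomial, smul_eq_mul,
      Finset.mul_sum, hcf]
    apply Finset.sum_congr rfl
    intro k _
    apply Finset.sum_congr rfl
    intro j _
    ring
  have h0 := poly_small (N+1) P C t0 ht0 (by
    intro t h1 h2
    rw [hPe]; exact hC t h1 h2) N (by omega)
  simp only [hP, Polynomial.finsetSum_coeff, Polynomial.coeff_monomial] at h0
  rw [Finset.sum_sigma', ← Finset.sum_filter] at h0
  rw [← h0]
  symm
  refine Finset.sum_bij' (fun a _ => a.2) (fun j _ => ⟨N - j, j⟩) ?_ ?_ ?_ ?_ ?_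
  · intro a ha
    simp only [Finset.mem_filter, Finset.mem_sigma, Finset.mem_range] at ha ⊢
    omega
  · intro j hj
    simp only [Finset.mem_filter, Finset.mem_sigma, Finset.mem_range] at hj ⊢
    omega
  · rintro ⟨k, j⟩ ha
    simp only [Finset.mem_filter, Finset.mem_sigma, Finset.mem_range] at ha
    have : N - j = k := by omega
    subst this
    rfl
  · intro j hj; rfl
  · rintro ⟨k, j⟩ ha
    simp only [Finset.mem_filter, Finset.mem_sigma, Finset.mem_range] at ha
    have : k = N - j := by omega
    subst this
    simp only [hcf]
    rw [show N - j - j = N - 2 * j by omega]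
    ring

lemma jp_abs {p : ℝ} (hp : 1 < p) (t : ℝ) : |Jp p t| = |t| ^ (p - 1) := by
  unfold Jp
  rcases eq_or_ne t 0 with rfl | ht
  · simp [Real.zero_rpow (show p - 1 ≠ 0 by linarith)]
  · have : 0 < |t| := abs_pos.2 ht
    rw [abs_mul, abs_of_nonneg (Real.rpow_nonneg this.le _)]
    nth_rewrite 2 [← Real.rpow_one |t|]
    rw [← Real.rpow_add this]
    congr 1; ring

lemma jp_mul (p x y : ℝ) : Jp p (x * y) = Jp p x * Jp p y := by
  unfold Jp
  rw [abs_mul, Real.mul_rpow (abs_nonneg _) (abs_nonneg _)]; ring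

lemma jp_pos (p c : ℝ) (hc : 0 < c) : Jp p c = c ^ (p - 1) := by
  unfold Jp
  rw [abs_of_pos hc]
  nth_rewrite 2 [← Real.rpow_one c]
  rw [← Real.rpow_add hc]
  congr 1; ring

lemma jp_neg (p x : ℝ) : Jp p (-x) = - Jp p x := by
  unfold Jp; rw [abs_neg]; ring

lemma jp_meas (p : ℝ) : Measurable (Jp p) := by
  unfold Jp; fun_prop

lemma taylor_bd (v : ℝ) (M : ℕ) : ∃ C : ℝ, 0 < C ∧ ∀ w : ℝ, |w| ≤ 9/16 →
    |(1 + w) ^ v - ∑ k ∈ Finset.range M, Ring.choose v k * w ^ k| ≤ C * |w| ^ M := by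
  have h := (Real.one_add_rpow_hasFPowerSeriesOnBall_zero (a := v)).uniform_geometric_approx'
    (r' := 3/4) (by
      rw [← ENNReal.coe_one, ENNReal.coe_lt_coe, ← NNReal.coe_lt_coe]; norm_num)
  obtain ⟨a, ha, C, hC, h⟩ := h
  refine ⟨C * (a / (3/4)) ^ M, mul_pos hC (pow_pos (div_pos ha.1 (by norm_num)) _), ?_⟩
  intro w hw
  have h1 := h w (by
    rw [mem_ball_zero_iff, Real.norm_eq_abs]
    push_cast
    linarith) M
  simp only [zero_add, FormalMultilinearSeries.partialSum, binomialSeries_apply, smul_eq_mul,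
    Real.norm_eq_abs] at h1
  simp only [List.ofFn_const, List.prod_replicate] at h1
  refine h1.trans (le_of_eq ?_)
  push_cast
  rw [mul_assoc, ← mul_pow]
  congr 2
  ring

lemma jp_diff {p : ℝ} (hp : 1 < p) : ∃ C q : ℝ, 0 < C ∧ 0 < q ∧ ∀ a b : ℝ, |a| ≤ 1 →
    |Jp p (a - b) + Jp p b| ≤ C * |a| ^ q * (1 + |b| ^ (p - 1)) := by
  obtain ⟨C1, hC1, hT⟩ := taylor_bd (p - 1) 1
  set κ := p - 1 with hκ
  have hκ0 : 0 < κ := by linarith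
  set q := min κ 1 / 2 with hq
  have hq0 : 0 < q := by have : 0 < min κ 1 := lt_min hκ0 one_pos
                         positivity
  refine ⟨2 * 3 ^ κ + C1, q, by positivity, hq0, ?_⟩
  intro a b ha
  have hbk : 0 ≤ |b| ^ κ := by positivity
  have haq : 0 ≤ |a| ^ q := by positivity
  set η := |a| ^ (1/2 : ℝ) with hη
  have hη0 : 0 ≤ η := by positivity
  have hη1 : η ≤ 1 := Real.rpow_le_one (abs_nonneg _) ha (by norm_num)
  have hηη : η * η = |a| := by
    rw [hη, ← Real.rpow_add_of_nonneg (abs_nonneg _) (by norm_num) (by norm_num)]; norm_num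
  have haη : |a| ≤ η := by nlinarith
  have hηq : η ≤ |a| ^ q := by
    rcases eq_or_ne a 0 with rfl | ha0
    · simp [hη, Real.zero_rpow hq0.ne']
    · apply Real.rpow_le_rpow_of_exponent_ge (abs_pos.2 ha0) ha
      have := min_le_right κ 1
      linarith
  have hηκ : η ^ κ ≤ |a| ^ q := by
    rw [hη, ← Real.rpow_mul (abs_nonneg _)]
    rcases eq_or_ne a 0 with rfl | ha0
    · rw [abs_zero, Real.zero_rpow (by positivity), Real.zero_rpow hq0.ne']
    · apply Real.rpow_le_rpow_of_exponent_ge (abs_pos.2 ha0) ha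
      have := min_le_left κ 1
      linarith
  rcases le_or_gt |b| (2 * η) with hb | hb
  · have h1 : |Jp p (a - b)| ≤ 3 ^ κ * η ^ κ := by
      rw [jp_abs hp, ← Real.mul_rpow (by norm_num) hη0]
      apply Real.rpow_le_rpow (abs_nonneg _) _ hκ0.le
      have := abs_sub a b
      linarith
    have h2 : |Jp p b| ≤ 3 ^ κ * η ^ κ := by
      rw [jp_abs hp, ← Real.mul_rpow (by norm_num) hη0]
      apply Real.rpow_le_rpow (abs_nonneg _) _ hκ0.le
      linarith
    have h3 : (3:ℝ) ^ κ * η ^ κ ≤ 3 ^ κ * |a| ^ q := by gcongr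
    calc |Jp p (a - b) + Jp p b| ≤ |Jp p (a-b)| + |Jp p b| := abs_add_le _ _
      _ ≤ 2 * 3 ^ κ * |a| ^ q * 1 := by linarith
      _ ≤ (2 * 3 ^ κ + C1) * |a| ^ q * (1 + |b| ^ κ) := by
        gcongr <;> linarith
  · have hb0 : 0 < |b| := by linarith
    have hbne : b ≠ 0 := abs_pos.1 hb0
    set w := - a / b with hw
    have hwabs : |w| ≤ η / 2 := by
      rw [hw, abs_div, abs_neg, div_le_iff₀ hb0, ← hηη]
      nlinarith
    have hT1 := hT w (by linarith)
    have hw1 : 0 < 1 + w := by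
      have := neg_abs_le w
      linarith
    have e : a - b = (-b) * (1 + w) := by rw [hw]; field_simp; ring
    rw [e, jp_mul, jp_neg, jp_pos p _ hw1]
    have e2 : -Jp p b * (1 + w) ^ (p - 1) + Jp p b = - (Jp p b * ((1+w)^κ - 1)) := by ring
    rw [e2, abs_neg, abs_mul, jp_abs hp]
    simp at hT1
    have h5 : |(1+w)^κ - 1| ≤ C1 * |a| ^ q := by
      refine hT1.trans ?_
      gcongr
      linarith
    have h3 : (0:ℝ) < 2 * 3 ^ κ := by positivity
    calc |b| ^ κ * |(1+w)^κ - 1| ≤ |b| ^ κ * (C1 * |a| ^ q) := by gcongr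
      _ = C1 * |a| ^ q * |b| ^ κ := by ring
      _ ≤ (2 * 3 ^ κ + C1) * |a| ^ q * (1 + |b| ^ κ) := by
        gcongr <;> linarith

lemma holder_local {d : ℕ} {Ω : Set (Ed d)} (h0Ω : (0 : Ed d) ∈ Ω) {u : Ed d → ℝ} {β : ℝ} (hβ : 0 < β)
    (hreg : ∀ x ∈ Ω, ∃ r > 0, ball x r ⊆ Ω ∧
      ∃ C : ℝ≥0, HolderOnWith C β.toNNReal u (ball x r)) :
    ∃ r > 0, ball (0 : Ed d) r ⊆ Ω ∧ ∃ C : ℝ, 0 < C ∧ ∀ x ∈ ball (0 : Ed d) r, ∀ y ∈ ball (0 : Ed d) r,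
      |u x - u y| ≤ C * ‖x - y‖ ^ β := by
  obtain ⟨r, hr, hsub, C, hC⟩ := hreg 0 h0Ω
  refine ⟨r, hr, hsub, (C:ℝ) + 1, by positivity, ?_⟩
  intro x hx y hy
  have h := hC.edist_le hx hy
  rw [edist_nndist, edist_nndist, ← ENNReal.coe_rpow_of_nonneg _ (by positivity), ← ENNReal.coe_mul,
    ENNReal.coe_le_coe, ← NNReal.coe_le_coe] at h
  push_cast at h
  rw [Real.dist_eq, dist_eq_norm, Real.coe_toNNReal _ hβ.le] at h
  refine h.trans ?_
  gcongr
  linarith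

lemma mik_fin {d : ℕ} {s p : ℝ} (hp : 1 < p) {u : Ed d → ℝ} (hu : Measurable u) (hcar : carleman d s p u)
    (i : Fin d) (K : ℕ) : ∃ k ≥ K, mik d s p u i k ≠ ⊤ := by
  by_contra hcon
  push Not at hcon
  have h := hcar i
  have hz : ∀ k ∉ Finset.range K, (mik d s p u i (k + 1) ^ ((1 : ℝ) / (2 * ((k : ℝ) + 1))))⁻¹ = 0 := by
    intro k hk
    rw [hcon (k+1) (by simp at hk; omega), ENNReal.top_rpow_of_pos (by positivity), ENNReal.inv_top]
  rw [tsum_eq_sum hz, ENNReal.sum_eq_top] at h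
  obtain ⟨k, _, hk⟩ := h
  rw [ENNReal.inv_eq_top, ENNReal.rpow_eq_zero_iff] at hk
  have hk0 : mik d s p u i (k+1) = 0 := by
    rcases hk with hk | hk
    · exact hk.1
    · exfalso
      have : (0:ℝ) < 1 / (2 * ((k:ℝ)+1)) := by positivity
      linarith [hk.2]
  have hK := hcon (K+1) (by omega)
  unfold mik at hk0 hK
  rw [lintegral_eq_zero_iff (by fun_prop)] at hk0
  have : ∫⁻ x : Ed d, ENNReal.ofReal
    ((x i ^ (2 * (K+1)) / ‖x‖ ^ (4 * (K+1))) * (|u x| ^ (p - 1) / ‖x‖ ^ ((d : ℝ) + s * p))) = 0 := by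
    rw [lintegral_eq_zero_iff (by fun_prop)]
    filter_upwards [hk0] with x hx
    simp only [Pi.zero_apply, ENNReal.ofReal_eq_zero] at hx ⊢
    have hnn : 0 ≤ |u x| ^ (p - 1) / ‖x‖ ^ ((d : ℝ) + s * p) := by positivity
    by_cases hxi : x i = 0
    · simp [hxi]
    · have hx0 : x ≠ 0 := by rintro rfl; simp at hxi
      have hpos : 0 < x i ^ (2 * (k+1)) / ‖x‖ ^ (4 * (k+1)) := by
        have : 0 < ‖x‖ := norm_pos_iff.2 hx0
        have h2 : 0 < x i ^ (2 * (k+1)) := by rw [pow_mul]; positivity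
        positivity
      have : |u x| ^ (p - 1) / ‖x‖ ^ ((d : ℝ) + s * p) = 0 := by
        apply le_antisymm _ hnn
        by_contra hc
        push Not at hc
        have := mul_pos hpos hc
        linarith
      rw [this]; simp
  rw [this] at hK
  exact ENNReal.zero_ne_top hK

lemma mik_int {d : ℕ} {s p : ℝ} {u : Ed d → ℝ} (hu : Measurable u) (i : Fin d) (k : ℕ)
    (h : mik d s p u i k ≠ ⊤) : Integrable (fun x : Ed d =>
      (x i ^ (2 * k) / ‖x‖ ^ (4 * k)) * (|u x| ^ (p - 1) / ‖x‖ ^ ((d : ℝ) + s * p))) := by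
  refine (lintegral_ofReal_ne_top_iff_integrable (Measurable.aestronglyMeasurable (by fun_prop)) ?_).1 h
  filter_upwards with x
  have : 0 ≤ x i ^ (2 * k) := by rw [pow_mul]; positivity
  simp only [Pi.zero_apply]
  positivity

lemma ball_lower {d : ℕ} (hd : 1 ≤ d) {F : Ed d → ℝ} (hF : Integrable F) (hF0 : ∀ y, 0 ≤ F y) (x : Ed d) (r c : ℝ)
    (hr : 0 ≤ r) (h : ∀ y ∈ ball x r, c ≤ F y) :
    c * (r ^ d * volume.real (ball (0 : Ed d) 1)) ≤ ∫ y, F y := by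
  have h1 : ∫ y in ball x r, c ≤ ∫ y in ball x r, F y := by
    apply setIntegral_mono_on _ hF.integrableOn measurableSet_ball h
    exact integrableOn_const measure_ball_lt_top.ne
  have h2 : ∫ y in ball x r, F y ≤ ∫ y, F y :=
    setIntegral_le_integral hF (Eventually.of_forall hF0)
  rw [setIntegral_const, smul_eq_mul] at h1
  have h3 : volume.real (ball x r) = r ^ d * volume.real (ball (0 : Ed d) 1) := by
    have : Nontrivial (Ed d) := by
      have : Nonempty (Fin d) := ⟨⟨0, hd⟩⟩
      infer_instance
    have := Measure.addHaar_ball (volume : Measure (Ed d)) x hr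
    rw [finrank_euclideanSpace_fin] at this
    rw [measureReal_def, this, ENNReal.toReal_mul, ENNReal.toReal_ofReal (by positivity), measureReal_def]
  rw [h3] at h1
  linarith

lemma vol_pos (d : ℕ) : 0 < volume.real (ball (0 : Ed d) 1) :=
  ENNReal.toReal_pos (measure_ball_pos _ _ one_pos).ne' measure_ball_lt_top.ne

lemma u_zero {d : ℕ} (hd : 1 ≤ d) {s p : ℝ} (hs : 0 < s) (hp : 1 < p) {u : Ed d → ℝ} (hu : Measurable u)
    (hcar : carleman d s p u) (hc : ContinuousAt u 0) : u 0 = 0 := by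
  by_contra h0
  set a := |u 0| / 2 with ha
  have ha0 : 0 < a := by have := abs_pos.2 h0; positivity
  have hev : ∀ᶠ x in nhds (0 : Ed d), a ≤ |u x| := by
    have := hc.abs.eventually (lt_mem_nhds (show a < |u 0| by have := abs_pos.2 h0; rw [ha]; linarith))
    filter_upwards [this] with x hx using hx.le
  obtain ⟨r0, hr0, hball⟩ := Metric.eventually_nhds_iff_ball.1 hev
  set i : Fin d := ⟨0, hd⟩
  obtain ⟨k, _, hk⟩ := mik_fin hp hu hcar i 0
  have hinte := mik_int hu i k hk
  set F := (fun x : Ed d =>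
      (x i ^ (2 * k) / ‖x‖ ^ (4 * k)) * (|u x| ^ (p - 1) / ‖x‖ ^ ((d : ℝ) + s * p))) with hF
  have hsp : 0 < s * p := by positivity
  set v := volume.real (ball (0 : Ed d) 1) with hv
  have hv0 : 0 < v := vol_pos d
  set I := ∫ y, F y with hI
  have hF0 : ∀ y, 0 ≤ F y := by
    intro x
    have : 0 ≤ x i ^ (2 * k) := by rw [pow_mul]; positivity
    simp only [hF]; positivity
  have hI0 : 0 ≤ I := integral_nonneg hF0
  set c0 := (1/2)^(2*k) * (1/2)^d * a ^ (p-1) * v with hc0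
  have hc0p : 0 < c0 := by positivity
  set I' := I * (2 ^ (4*k) * 2 ^ ((d:ℝ) + s*p)) with hI'
  have key : ∀ ρ : ℝ, 0 < ρ → ρ < min 1 (r0/2) → c0 ≤ I' * ρ ^ (s*p) := by
    intro ρ hρ hρ2
    have hρ1 : ρ ≤ 1 := (hρ2.trans_le (min_le_left _ _)).le
    have hρr : ρ < r0/2 := hρ2.trans_le (min_le_right _ _)
    have hb := ball_lower hd hinte hF0 (EuclideanSpace.single i ρ) (ρ/2)
      ((ρ/2)^(2*k) / (2*ρ)^(4*k) * (a^(p-1) / (2*ρ)^((d:ℝ)+s*p))) (by positivity) (by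
      intro y hy
      rw [mem_ball, dist_eq_norm] at hy
      have hyi : ρ/2 ≤ y i := by
        have h1 := PiLp.norm_apply_le (y - EuclideanSpace.single i ρ) i
        simp only [PiLp.sub_apply, EuclideanSpace.single_apply, if_true, Real.norm_eq_abs] at h1
        have := neg_abs_le (y i - ρ)
        linarith
      have hyn : ‖y‖ ≤ 2 * ρ := by
        have h1 := norm_le_norm_add_norm_sub' y (EuclideanSpace.single i ρ)
        rw [EuclideanSpace.norm_single, Real.norm_eq_abs, abs_of_pos hρ] at h1
        linarith
      have hy0 : 0 < ‖y‖ := by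
        have h1 := PiLp.norm_apply_le y i
        rw [Real.norm_eq_abs] at h1
        have := le_abs_self (y i)
        linarith
      have hua : a ≤ |u y| := hball y (by rw [mem_ball_zero_iff]; linarith)
      simp only [hF]
      have hyi0 : 0 < y i := by linarith
      gcongr)
    rw [← hI, ← hv] at hb
    have e1 : (2*ρ)^((d:ℝ)+s*p) = 2^((d:ℝ)+s*p) * (ρ^d * ρ^(s*p)) := by
      rw [Real.mul_rpow (by norm_num) hρ.le, Real.rpow_add hρ, Real.rpow_natCast]
    rw [e1] at hb
    have hden : 0 < (2*ρ)^(4*k) * (2^((d:ℝ)+s*p) * (ρ^d * ρ^(s*p))) := by positivity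
    have hb2 : (ρ/2)^(2*k) * a^(p-1) * ((ρ/2)^d * v) ≤ I * ((2*ρ)^(4*k) * (2^((d:ℝ)+s*p) * (ρ^d * ρ^(s*p)))) := by
      rw [← div_le_iff₀ hden]
      refine le_trans (le_of_eq ?_) hb
      field_simp
    have hρ2k : ρ ^ (4*k) ≤ ρ^(2*k) := pow_le_pow_of_le_one hρ.le hρ1 (by omega)
    have hpos : 0 < ρ^(2*k) * ρ^d := by positivity
    have hb3 : c0 * (ρ^(2*k) * ρ^d) ≤ I' * ρ^(s*p) * (ρ^(2*k) * ρ^d) := by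
      calc c0 * (ρ^(2*k) * ρ^d) = (ρ/2)^(2*k) * a^(p-1) * ((ρ/2)^d * v) := by
            rw [hc0]; simp only [div_pow, one_pow]; ring
        _ ≤ I * ((2*ρ)^(4*k) * (2^((d:ℝ)+s*p) * (ρ^d * ρ^(s*p)))) := hb2
        _ = I * (2 ^ (4*k) * 2 ^ ((d:ℝ) + s*p)) * ρ^(s*p) * (ρ^(4*k) * ρ^d) := by
            rw [mul_pow]; ring
        _ ≤ I * (2 ^ (4*k) * 2 ^ ((d:ℝ) + s*p)) * ρ^(s*p) * (ρ^(2*k) * ρ^d) := by gcongr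
    exact le_of_mul_le_mul_right hb3 hpos
  have hlim : Tendsto (fun ρ : ℝ => I' * ρ ^ (s*p)) (nhdsWithin 0 (Ioi 0)) (nhds (I' * 0 ^ (s*p))) := by
    have : Continuous (fun ρ : ℝ => I' * ρ ^ (s*p)) :=
      continuous_const.mul (Real.continuous_rpow_const hsp.le)
    exact (this.tendsto 0).mono_left nhdsWithin_le_nhds
  have := ge_of_tendsto hlim (b := c0) (by
    have : 0 < min 1 (r0/2) := lt_min one_pos (by positivity)
    filter_upwards [Ioo_mem_nhdsGT this] with ρ hρ using key ρ hρ.1 hρ.2)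
  rw [Real.zero_rpow hsp.ne', mul_zero] at this
  linarith

lemma tail_comp {r1 t L : ℝ} (hr : 0 < r1) (h : r1 ≤ t) (hL : 0 ≤ L) :
    (t ^ L)⁻¹ ≤ (1 / r1 + 1) ^ L * ((1 + t) ^ L)⁻¹ := by
  have ht : 0 < t := by linarith
  rw [← div_eq_mul_inv, le_div_iff₀ (by positivity), inv_mul_le_iff₀ (by positivity),
    ← Real.mul_rpow (by positivity) (by positivity)]
  apply Real.rpow_le_rpow (by positivity) _ hL
  have : 1 ≤ t * (1 / r1) := by rw [mul_one_div, le_div_iff₀ hr]; linarith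
  nlinarith

lemma int_zero {d : ℕ} (hd : 1 ≤ d) {s p : ℝ} (hs : 0 < s) (hp : 1 < p) {u : Ed d → ℝ}
    (hu : memTail d s p u) {β : ℝ} (hβ : s * p / (p - 1) < β) {r C : ℝ} (hr : 0 < r) (hC : 0 < C)
    (hH : ∀ x ∈ ball (0 : Ed d) r, |u x| ≤ C * ‖x‖ ^ β) :
    Integrable (fun y : Ed d => |u y| ^ (p - 1) / ‖y‖ ^ ((d : ℝ) + s * p)) := by
  obtain ⟨hm, ht⟩ := hu
  have hp1 : 0 < p - 1 := by linarith
  have hsp : 0 < s * p := by positivity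
  have hβ' : s * p < β * (p - 1) := by rwa [div_lt_iff₀ hp1] at hβ
  rw [← integrableOn_univ, ← union_compl_self (ball (0 : Ed d) r), integrableOn_union]
  constructor
  · refine integrableOn_ball_of_norm_le_rpow (C := C ^ (p-1)) (α := (d:ℝ) + s * p - β * (p - 1)) ?_ ?_ ?_ ?_
    · rw [finrank_euclideanSpace_fin]; exact hd
    · rw [finrank_euclideanSpace_fin]; linarith
    · rw [ae_restrict_iff' measurableSet_ball]
      have h0 : ∀ᵐ x : Ed d, x ≠ 0 := by
        have : Nontrivial (Ed d) := by
          have : Nonempty (Fin d) := ⟨⟨0, hd⟩⟩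
          infer_instance
        exact Measure.ae_ne _ 0
      filter_upwards [h0] with x hx0 hx
      have hn : 0 < ‖x‖ := norm_pos_iff.2 hx0
      rw [Real.norm_eq_abs, abs_of_nonneg (by positivity)]
      rw [show -((d:ℝ) + s * p - β * (p - 1)) = β * (p-1) - ((d:ℝ) + s * p) by ring, Real.rpow_sub hn, ← mul_div_assoc]
      gcongr
      rw [Real.rpow_mul hn.le, ← Real.mul_rpow hC.le (by positivity)]
      apply Real.rpow_le_rpow (abs_nonneg _) (hH x hx) hp1.le
    · exact Measurable.aestronglyMeasurable (by fun_prop)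
  · apply Integrable.mono' ((ht.const_mul ((1 / r + 1) ^ ((d:ℝ) + s * p))).integrableOn (s := (ball (0 : Ed d) r)ᶜ))
    · exact Measurable.aestronglyMeasurable (by fun_prop)
    · rw [ae_restrict_iff' measurableSet_ball.compl]
      filter_upwards with x hx
      have hx' : r ≤ ‖x‖ := by simpa using hx
      rw [Real.norm_eq_abs, abs_of_nonneg (by positivity), div_eq_mul_inv, div_eq_mul_inv]
      have := tail_comp hr hx' (L := (d:ℝ) + s * p) (by positivity)
      calc _ ≤ |u x| ^ (p-1) * ((1 / r + 1) ^ ((d:ℝ) + s * p) * ((1 + ‖x‖) ^ ((d:ℝ) + s * p))⁻¹) := by gcongr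
        _ = _ := by ring

lemma int_all {d : ℕ} (hd : 1 ≤ d) {s p : ℝ} (hp : 1 < p) {u : Ed d → ℝ}
    (hu : Measurable u) (hcar : carleman d s p u)
    (h0 : Integrable (fun y : Ed d => |u y| ^ (p - 1) / ‖y‖ ^ ((d : ℝ) + s * p))) (n : ℕ) :
    Integrable (fun y : Ed d => |u y| ^ (p - 1) / ‖y‖ ^ ((d : ℝ) + s * p) * (‖y‖⁻¹) ^ n) := by
  have hk : ∀ i : Fin d, ∃ k, n ≤ k ∧ mik d s p u i k ≠ ⊤ := by
    intro i
    obtain ⟨k, hk, h⟩ := mik_fin hp hu hcar i n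
    exact ⟨k, hk, h⟩
  choose k hkn hk using hk
  have hb : Integrable (fun y : Ed d => (d:ℝ)^n * ∑ i, (|u y| ^ (p - 1) / ‖y‖ ^ ((d : ℝ) + s * p) +
      (y i ^ (2 * k i) / ‖y‖ ^ (4 * k i)) * (|u y| ^ (p - 1) / ‖y‖ ^ ((d : ℝ) + s * p)))) := by
    apply Integrable.const_mul
    apply integrable_finsetSum
    intro i _
    exact h0.add (mik_int hu i (k i) (hk i))
  apply hb.mono'
  · exact Measurable.aestronglyMeasurable (by fun_prop)
  · filter_upwards with y
    set G := |u y| ^ (p - 1) / ‖y‖ ^ ((d : ℝ) + s * p) with hG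
    have hG0 : 0 ≤ G := by positivity
    rw [Real.norm_eq_abs, abs_of_nonneg (by positivity)]
    obtain ⟨i, _, hi⟩ := Finset.exists_max_image Finset.univ (fun i : Fin d => |y i|) ⟨⟨0, hd⟩, Finset.mem_univ _⟩
    have hny : ‖y‖ ≤ d * |y i| := by
      rw [EuclideanSpace.norm_eq]
      apply Real.sqrt_le_iff.2 ⟨by positivity, ?_⟩
      calc ∑ j, ‖y j‖ ^ 2 ≤ ∑ j : Fin d, |y i| ^ 2 := by
            apply Finset.sum_le_sum
            intro j hj
            rw [Real.norm_eq_abs]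
            have := hi j hj
            gcongr
        _ = d * |y i| ^ 2 := by simp
        _ ≤ (d * |y i|) ^ 2 := by
            rw [mul_pow]
            gcongr
            have : (1:ℝ) ≤ d := by exact_mod_cast hd
            nlinarith
    have hz : ‖y‖⁻¹ ≤ d * (|y i| / ‖y‖^2) := by
      rcases eq_or_ne y 0 with rfl | hy
      · simp
      · have : 0 < ‖y‖ := norm_pos_iff.2 hy
        rw [← mul_div_assoc, le_div_iff₀ (by positivity)]
        calc ‖y‖⁻¹ * ‖y‖^2 = ‖y‖ := by field_simp
          _ ≤ _ := hny
    have hzn : (‖y‖⁻¹)^n ≤ d^n * (1 + y i ^ (2 * k i) / ‖y‖ ^ (4 * k i)) := by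
      calc (‖y‖⁻¹)^n ≤ (d * (|y i| / ‖y‖^2))^n := by gcongr
        _ = d^n * (|y i| / ‖y‖^2)^n := mul_pow _ _ _
        _ ≤ _ := by
          gcongr
          set Z := |y i| / ‖y‖^2 with hZ
          have hZ0 : 0 ≤ Z := by positivity
          have e : y i ^ (2 * k i) / ‖y‖ ^ (4 * k i) = Z ^ (2 * k i) := by
            rw [hZ, div_pow, ← pow_mul, pow_mul |y i|, sq_abs, ← pow_mul]; congr 2; ring
          rw [e]
          rcases le_total Z 1 with h | h
          · have := pow_le_one₀ hZ0 h (n := n)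
            have : 0 ≤ Z ^ (2 * k i) := by positivity
            linarith
          · have := pow_le_pow_right₀ h (show n ≤ 2 * k i by have := hkn i; omega)
            linarith
    have hterm : ∀ j : Fin d, 0 ≤ G + (y j ^ (2 * k j) / ‖y‖ ^ (4 * k j)) * G := by
      intro j
      have : 0 ≤ y j ^ (2 * k j) := by rw [pow_mul]; positivity
      positivity
    calc G * (‖y‖⁻¹)^n ≤ G * (d^n * (1 + y i ^ (2 * k i) / ‖y‖ ^ (4 * k i))) := by gcongr
      _ = d^n * (G + (y i ^ (2 * k i) / ‖y‖ ^ (4 * k i)) * G) := by ring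
      _ ≤ _ := by
        gcongr
        exact Finset.single_le_sum (f := fun j => G + (y j ^ (2 * k j) / ‖y‖ ^ (4 * k j)) * G) (fun j _ => hterm j) (Finset.mem_univ i)

set_option maxHeartbeats 1000000 in
lemma decay {d : ℕ} (hd : 1 ≤ d) {L κ β r1 C : ℝ} {u : Ed d → ℝ} (hL : 0 < L) (hκ : 0 < κ) (hβ : 0 < β)
    (hr1 : 0 < r1) (hC : 0 < C)
    (hH : ∀ x ∈ ball (0 : Ed d) r1, ∀ y ∈ ball (0 : Ed d) r1, |u x - u y| ≤ C * ‖x - y‖ ^ β)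
    (h0 : u 0 = 0)
    (In : ∀ n : ℕ, Integrable (fun y : Ed d => |u y| ^ κ / ‖y‖ ^ L * (‖y‖⁻¹) ^ n)) (n : ℕ) :
    ∃ C' r0 : ℝ, 0 < C' ∧ 0 < r0 ∧ ∀ x : Ed d, ‖x‖ < r0 → |u x| ≤ C' * ‖x‖ ^ n := by
  set E := κ + d / β with hE
  have hE0 : 0 < E := by positivity
  obtain ⟨N, hN⟩ := exists_nat_ge ((n:ℝ) * E)
  set I := ∫ y, |u y| ^ κ / ‖y‖ ^ L * (‖y‖⁻¹) ^ N with hI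
  have hI0 : 0 ≤ I := integral_nonneg (fun y => by positivity)
  set v := volume.real (ball (0 : Ed d) 1) with hv
  have hv0 : 0 < v := vol_pos d
  set m := (1/2:ℝ)^κ * (1/(2*C)) ^ ((d:ℝ)/β) * v with hm
  have hm0 : 0 < m := by positivity
  set K := I / m + 1 with hK
  have hK0 : 0 < K := by positivity
  refine ⟨K ^ (1/E) * 2 ^ n, min (r1/2) (1/2), by positivity, by positivity, ?_⟩
  intro x hx
  have hx1 : ‖x‖ < r1 / 2 := hx.trans_le (min_le_left _ _)
  have hx2 : ‖x‖ < 1 / 2 := hx.trans_le (min_le_right _ _)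
  rcases eq_or_ne (u x) 0 with hux | hux
  · rw [hux]; simp; positivity
  have hx0 : x ≠ 0 := by rintro rfl; exact hux h0
  have hr : 0 < ‖x‖ := norm_pos_iff.2 hx0
  set r := ‖x‖ with hrdef
  set a := |u x| with ha
  have ha0 : 0 < a := abs_pos.2 hux
  have hxb : x ∈ ball (0 : Ed d) r1 := by rw [mem_ball_zero_iff]; linarith
  have har : a ≤ C * r ^ β := by
    have := hH x hxb 0 (by simpa using hr1)
    rwa [h0, sub_zero, sub_zero] at this
  set ρ := (a / (2*C)) ^ (1/β) with hρ
  have hρ0 : 0 < ρ := by positivity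
  have hρβ : ρ ^ β = a / (2*C) := by
    rw [hρ, ← Real.rpow_mul (by positivity), one_div_mul_cancel hβ.ne', Real.rpow_one]
  have hρr : ρ ≤ r := by
    rw [← Real.rpow_le_rpow_iff hρ0.le hr.le hβ, hρβ, div_le_iff₀ (by positivity)]
    have : 0 < r ^ β * C := by positivity
    linarith
  have hb := ball_lower hd (In N) (fun y => by positivity) x ρ
    ((a/2)^κ / (2*r)^L * ((2*r)⁻¹)^N) hρ0.le (by
      intro y hy
      rw [mem_ball, dist_eq_norm] at hy
      have hyn : ‖y‖ ≤ 2 * r := by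
        have h1 := norm_le_norm_add_norm_sub' y x
        linarith
      have hy0 : 0 < ‖y‖ := by
        have h1 := norm_le_norm_add_norm_sub' x y
        rw [norm_sub_rev] at h1
        linarith
      have hyb : y ∈ ball (0 : Ed d) r1 := by rw [mem_ball_zero_iff]; linarith
      have hua : a / 2 ≤ |u y| := by
        have h1 := hH x hxb y hyb
        have h2 : ‖x - y‖ ^ β ≤ ρ ^ β := by
          rw [norm_sub_rev]
          exact Real.rpow_le_rpow (norm_nonneg _) hy.le hβ.le
        rw [hρβ] at h2
        have h3 : C * ‖x - y‖ ^ β ≤ a / 2 := by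
          calc C * ‖x - y‖ ^ β ≤ C * (a / (2*C)) := by gcongr
            _ = a / 2 := by field_simp
        have h4 := abs_sub_abs_le_abs_sub (u x) (u y)
        linarith
      gcongr)
  rw [← hI, ← hv, inv_pow] at hb
  clear_value I v
  have hρd : ρ ^ d = (1/(2*C)) ^ ((d:ℝ)/β) * a ^ ((d:ℝ)/β) := by
    rw [hρ, ← Real.rpow_natCast, ← Real.rpow_mul (by positivity), ← Real.mul_rpow (by positivity) (by positivity)]
    congr 1 <;> ring
  have ha2 : (a/2)^κ = (1/2)^κ * a^κ := by
    rw [← Real.mul_rpow (by positivity) (by positivity)]; congr 1; ring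
  have hpow : a ^ E * m ≤ I * (2*r)^N := by
    have h2L : (2*r)^L ≤ 1 := Real.rpow_le_one (by positivity) (by linarith) hL.le
    have h1 : (a/2)^κ * (ρ^d * v) ≤ I * ((2*r)^L * (2*r)^N) := by
      rw [← div_le_iff₀ (by positivity)]
      refine le_trans (le_of_eq ?_) hb
      field_simp
    calc a ^ E * m = (a/2)^κ * (ρ^d * v) := by
          rw [ha2, hρd, hm, hE, Real.rpow_add ha0]; ring
      _ ≤ I * ((2*r)^L * (2*r)^N) := h1
      _ ≤ I * (1 * (2*r)^N) := by gcongr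
      _ = _ := by ring
  have hpow2 : a ^ E ≤ K * ((2*r)^n) ^ E := by
    have h2r : (2*r)^N ≤ ((2*r)^n)^E := by
      rw [← Real.rpow_natCast, ← Real.rpow_natCast, ← Real.rpow_mul (by positivity)]
      exact Real.rpow_le_rpow_of_exponent_ge (by positivity) (by linarith) hN
    rw [← le_div_iff₀ hm0] at hpow
    calc a ^ E ≤ I * (2*r)^N / m := hpow
      _ = (I / m) * (2*r)^N := by ring
      _ ≤ K * ((2*r)^n) ^ E := by
        gcongr
        rw [hK]; linarith
  have := Real.rpow_le_rpow (by positivity) hpow2 (show 0 ≤ 1/E by positivity)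
  rw [Real.mul_rpow (by positivity) (by positivity), ← Real.rpow_mul ha0.le, ← Real.rpow_mul (by positivity),
    mul_one_div_cancel hE0.ne', Real.rpow_one, Real.rpow_one, mul_pow] at this
  linarith

/-- rapid decay at the origin -/
def Rap {d : ℕ} (g : Ed d → ℝ) : Prop :=
  ∀ n : ℕ, ∃ C r0 : ℝ, 0 < C ∧ 0 < r0 ∧ ∀ x : Ed d, x ≠ 0 → ‖x‖ < r0 → |g x| ≤ C * ‖x‖ ^ n

lemma Rap.mono {d : ℕ} {g h : Ed d → ℝ} (hh : Rap h) (K r : ℝ) (hr : 0 < r)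
    (H : ∀ x : Ed d, x ≠ 0 → ‖x‖ < r → |g x| ≤ K * |h x|) : Rap g := by
  intro n
  obtain ⟨C, r0, hC, hr0, h1⟩ := hh n
  refine ⟨(|K|+1) * C, min r r0, by positivity, by positivity, ?_⟩
  intro x hx hx2
  have h2 := h1 x hx (hx2.trans_le (min_le_right _ _))
  calc |g x| ≤ K * |h x| := H x hx (hx2.trans_le (min_le_left _ _))
    _ ≤ (|K|+1) * |h x| := by
      gcongr
      linarith [le_abs_self K]
    _ ≤ (|K|+1) * (C * ‖x‖^n) := by gcongr
    _ = _ := by ring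

lemma Rap.add {d : ℕ} {g h : Ed d → ℝ} (hg : Rap g) (hh : Rap h) : Rap (fun x => g x + h x) := by
  intro n
  obtain ⟨C, r0, hC, hr0, h1⟩ := hh n
  obtain ⟨C', r0', hC', hr0', h1'⟩ := hg n
  refine ⟨C' + C, min r0 r0', by positivity, by positivity, ?_⟩
  intro x hx hx2
  have h2 := h1 x hx (hx2.trans_le (min_le_left _ _))
  have h3 := h1' x hx (hx2.trans_le (min_le_right _ _))
  calc |g x + h x| ≤ |g x| + |h x| := abs_add_le _ _
    _ ≤ _ := by rw [add_mul]; linarith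

lemma Rap.rpow {d : ℕ} {g : Ed d → ℝ} (hg : Rap g) {q : ℝ} (hq : 0 < q) : Rap (fun x => |g x| ^ q) := by
  intro n
  obtain ⟨N, hN⟩ := exists_nat_ge ((n:ℝ) / q)
  obtain ⟨C, r0, hC, hr0, h1⟩ := hg N
  refine ⟨C ^ q, min r0 1, by positivity, by positivity, ?_⟩
  intro x hx hx2
  have h2 := h1 x hx (hx2.trans_le (min_le_left _ _))
  have hr : 0 < ‖x‖ := norm_pos_iff.2 hx
  have hx1 : ‖x‖ ≤ 1 := (hx2.trans_le (min_le_right _ _)).le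
  rw [abs_of_nonneg (by positivity)]
  calc |g x| ^ q ≤ (C * ‖x‖^N) ^ q := Real.rpow_le_rpow (abs_nonneg _) h2 hq.le
    _ = C ^ q * (‖x‖^N)^q := Real.mul_rpow hC.le (by positivity)
    _ ≤ C ^ q * ‖x‖^n := by
      gcongr
      rw [← Real.rpow_natCast, ← Real.rpow_natCast, ← Real.rpow_mul (by positivity)]
      apply Real.rpow_le_rpow_of_exponent_ge hr hx1
      rwa [div_le_iff₀ hq] at hN

lemma Rap.div_pow {d : ℕ} {g : Ed d → ℝ} (hg : Rap g) (k : ℕ) : Rap (fun x => g x / ‖x‖ ^ k) := by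
  intro n
  obtain ⟨C, r0, hC, hr0, h1⟩ := hg (n+k)
  refine ⟨C, r0, hC, hr0, ?_⟩
  intro x hx hx2
  have h2 := h1 x hx hx2
  have hr : 0 < ‖x‖ := norm_pos_iff.2 hx
  rw [abs_div, abs_of_nonneg (show 0 ≤ ‖x‖^k by positivity), div_le_iff₀ (by positivity)]
  rw [pow_add] at h2
  linarith

lemma rap_rhs {d : ℕ} {Ω : Set (Ed d)} (hΩ : IsOpen Ω) (h0Ω : (0 : Ed d) ∈ Ω)
    {f : Ed d → ℝ} (hf_van : ∀ n : ℕ, f =O[nhds (0 : Ed d)] fun x => ‖x‖ ^ n)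
    {V : Ed d → ℝ → ℝ} {ε₀ : ℝ} (hε₀ : 0 < ε₀) {n₀ : ℕ}
    (hV : ∃ C : ℝ, ∀ x ∈ Ω, ∀ t : ℝ, |V x t| * ‖x‖ ^ n₀ ≤ C * |t| ^ ε₀)
    {u : Ed d → ℝ} (hu : Rap u) : Rap (fun x => f x + V x (u x)) := by
  apply Rap.add
  · intro n
    obtain ⟨C, hC, h⟩ := (hf_van n).exists_pos
    obtain ⟨r0, hr0, hb⟩ := Metric.eventually_nhds_iff_ball.1 h.bound
    refine ⟨C, r0, hC, hr0, fun x _ hx => ?_⟩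
    have := hb x (by rwa [mem_ball_zero_iff])
    simpa using this
  · obtain ⟨C, hC⟩ := hV
    obtain ⟨r, hr, hb⟩ := Metric.isOpen_iff.1 hΩ 0 h0Ω
    refine ((hu.rpow hε₀).div_pow n₀).mono C r hr ?_
    intro x hx hxr
    have h := hC x (hb (by rwa [mem_ball_zero_iff])) (u x)
    have hn : 0 < ‖x‖ := norm_pos_iff.2 hx
    rw [abs_of_nonneg (by positivity : 0 ≤ |u x| ^ ε₀ / ‖x‖^n₀), ← mul_div_assoc, le_div_iff₀ (by positivity)]
    exact h

set_option maxHeartbeats 1000000 in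
lemma near_int {d : ℕ} (hd : 1 ≤ d) {s p β r1 C : ℝ} {u : Ed d → ℝ} (hum : Measurable u) (hs : 0 < s) (hp : 1 < p)
    (hβ : s * p / (p - 1) < β) (hr1 : 0 < r1) (hC : 0 < C)
    (hH : ∀ x ∈ ball (0 : Ed d) r1, ∀ y ∈ ball (0 : Ed d) r1, |u x - u y| ≤ C * ‖x - y‖ ^ β)
    (hD : ∀ n : ℕ, ∃ C' r0 : ℝ, 0 < C' ∧ 0 < r0 ∧ ∀ x : Ed d, ‖x‖ < r0 → |u x| ≤ C' * ‖x‖ ^ n) (n : ℕ) :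
    ∃ C' r0 : ℝ, 0 < C' ∧ 0 < r0 ∧ ∀ x : Ed d, x ≠ 0 → ‖x‖ < r0 →
      IntegrableOn (fun y => Jp p (u x - u y) / ‖x - y‖ ^ ((d:ℝ) + s * p)) (ball 0 (4 * ‖x‖)) ∧
      |∫ y in ball 0 (4 * ‖x‖), Jp p (u x - u y) / ‖x - y‖ ^ ((d:ℝ) + s * p)| ≤ C' * ‖x‖ ^ n := by
  have hp1 : 0 < p - 1 := by linarith
  have hsp : 0 < s * p := by positivity
  have hβ' : s * p < β * (p - 1) := by rwa [div_lt_iff₀ hp1] at hβ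
  have hβ0 : 0 < β := lt_trans (by positivity) hβ
  -- exponents
  set q1 := (β * (p-1) - s*p) / (2 * β) with hq1
  set q2 := (β * (p-1) + s*p) / (2 * β) with hq2
  have hq1p : 0 < q1 := by rw [hq1]; apply div_pos <;> linarith
  have hq2p : 0 < q2 := by positivity
  have hq12 : p - 1 = q1 + q2 := by rw [hq1, hq2]; field_simp; ring
  set g := β * q2 with hg
  have hgs : s * p < g := by
    have : g = (β * (p-1) + s*p)/2 := by rw [hg, hq2]; field_simp
    rw [this]; linarith
  set e := (d:ℝ) + s * p - g with he
  set h := (ball (0 : Ed d) 1).indicator (fun v => ‖v‖ ^ (-e)) with hh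
  have hnt : Nontrivial (Ed d) := by
    have : Nonempty (Fin d) := ⟨⟨0, hd⟩⟩
    infer_instance
  have hhint : Integrable h := by
    rw [hh, integrable_indicator_iff measurableSet_ball]
    refine integrableOn_ball_of_norm_le_rpow (C := 1) (α := e) ?_ ?_ ?_ ?_
    · rw [finrank_euclideanSpace_fin]; exact hd
    · rw [finrank_euclideanSpace_fin]; linarith
    · filter_upwards with x
      rw [one_mul, Real.norm_eq_abs, abs_of_nonneg (by positivity)]
    · exact Measurable.aestronglyMeasurable (by fun_prop)
  have hh0 : ∀ v, 0 ≤ h v := fun v => indicator_nonneg (fun v _ => by positivity) v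
  set I := ∫ v, h v with hI
  have hI0 : 0 ≤ I := integral_nonneg hh0
  obtain ⟨N, hN⟩ := exists_nat_ge ((n:ℝ) / q1)
  obtain ⟨A, r0, hA, hr0, hdec⟩ := hD N
  set K := (2 * A * 4 ^ N) ^ q1 * C ^ q2 with hK
  have hK0 : 0 < K := by positivity
  refine ⟨K * (I + 1), min (min (r0/4) (r1/4)) (1/5), by positivity, by positivity, ?_⟩
  intro x hx hxr
  have hxr0 : ‖x‖ < r0/4 := hxr.trans_le ((min_le_left _ _).trans (min_le_left _ _))
  have hxr1 : ‖x‖ < r1/4 := hxr.trans_le ((min_le_left _ _).trans (min_le_right _ _))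
  have hx5 : ‖x‖ < 1/5 := hxr.trans_le (min_le_right _ _)
  have hr : 0 < ‖x‖ := norm_pos_iff.2 hx
  have hbd : ∀ᵐ y ∂(volume.restrict (ball (0 : Ed d) (4 * ‖x‖))),
      ‖Jp p (u x - u y) / ‖x - y‖ ^ ((d:ℝ) + s * p)‖ ≤ K * ‖x‖ ^ n * h (x - y) := by
    rw [ae_restrict_iff' measurableSet_ball]
    filter_upwards [Measure.ae_ne volume x] with y hyx hy
    rw [mem_ball_zero_iff] at hy
    have hxy : 0 < ‖x - y‖ := norm_pos_iff.2 (sub_ne_zero.2 (Ne.symm hyx))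
    have hxy1 : ‖x - y‖ < 1 := by
      have := norm_sub_le x y
      linarith
    have hhxy : h (x - y) = ‖x - y‖ ^ (-e) := by
      rw [hh, indicator_of_mem]; rwa [mem_ball_zero_iff]
    rw [hhxy, Real.norm_eq_abs, abs_div, jp_abs hp, abs_of_nonneg (by positivity : 0 ≤ ‖x - y‖ ^ ((d:ℝ) + s * p))]
    set D := |u x - u y| with hDd
    have hD1 : D ≤ 2 * A * 4 ^ N * ‖x‖^N := by
      have h1 := hdec x (by linarith)
      have h2 := hdec y (by linarith)
      have h3 : ‖y‖^N ≤ (4 * ‖x‖)^N := by gcongr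
      have h4 := abs_sub (u x) (u y)
      rw [mul_pow] at h3
      have h5 : ‖x‖^N ≤ 4^N * ‖x‖^N := by
        have : (1:ℝ) ≤ 4^N := one_le_pow₀ (by norm_num)
        have : 0 ≤ ‖x‖^N := by positivity
        nlinarith
      calc D ≤ |u x| + |u y| := h4
        _ ≤ A * (4^N * ‖x‖^N) + A * (4^N * ‖x‖^N) := by
          apply add_le_add
          · exact h1.trans (by gcongr)
          · exact h2.trans (by gcongr)
        _ = _ := by ring
    have hD2 : D ≤ C * ‖x - y‖ ^ β := hH x (by rw [mem_ball_zero_iff]; linarith) y (by rw [mem_ball_zero_iff]; linarith)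
    have hD0 : 0 ≤ D := abs_nonneg _
    have hxn : (‖x‖^N)^q1 ≤ ‖x‖^n := by
      rw [← Real.rpow_natCast, ← Real.rpow_natCast, ← Real.rpow_mul (by positivity)]
      apply Real.rpow_le_rpow_of_exponent_ge hr (by linarith)
      rwa [div_le_iff₀ hq1p] at hN
    have e1 : ‖x - y‖ ^ (-e) = (‖x-y‖ ^ β) ^ q2 / ‖x - y‖ ^ ((d:ℝ) + s * p) := by
      rw [← Real.rpow_mul hxy.le, ← Real.rpow_sub hxy]; congr 1; rw [he]; ring
    rw [e1, ← mul_div_assoc]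
    gcongr
    calc D ^ (p-1) = D ^ q1 * D ^ q2 := by
          rw [hq12, Real.rpow_add_of_nonneg hD0 hq1p.le hq2p.le]
      _ ≤ (2 * A * 4 ^ N * ‖x‖^N) ^ q1 * (C * ‖x - y‖ ^ β) ^ q2 := by gcongr
      _ = K * (‖x‖^N) ^ q1 * (‖x-y‖ ^ β) ^ q2 := by
        rw [Real.mul_rpow (by positivity) (by positivity), Real.mul_rpow hC.le (by positivity), hK]; ring
      _ ≤ K * ‖x‖^n * (‖x-y‖ ^ β) ^ q2 := by gcongr
  have hinte : Integrable (fun y => K * ‖x‖^n * h (x - y)) := (hhint.comp_sub_left x).const_mul _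
  constructor
  · apply Integrable.mono' hinte.integrableOn _ hbd
    exact Measurable.aestronglyMeasurable (by have := jp_meas p; fun_prop)
  · calc |∫ y in ball 0 (4 * ‖x‖), Jp p (u x - u y) / ‖x - y‖ ^ ((d:ℝ) + s * p)|
        ≤ ∫ y in ball 0 (4 * ‖x‖), K * ‖x‖ ^ n * h (x - y) :=
          norm_integral_le_of_norm_le hinte.integrableOn hbd
      _ ≤ ∫ y, K * ‖x‖ ^ n * h (x - y) :=
          setIntegral_le_integral hinte (Eventually.of_forall fun y => mul_nonneg (by positivity) (hh0 _))
      _ = K * ‖x‖ ^ n * I := by rw [integral_const_mul, integral_sub_left_eq_self]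
      _ ≤ K * (I + 1) * ‖x‖^n := by
          have : 0 ≤ K * ‖x‖^n := by positivity
          nlinarith

lemma far_kernel {d : ℕ} {L : ℝ} (hL : 0 < L) {k : ℕ} (hk : L ≤ k) {x y : Ed d} (hx : x ≠ 0) (hx1 : ‖x‖ ≤ 1/3)
    (hy : y ∈ (ball (0 : Ed d) (4 * ‖x‖))ᶜ) :
    (‖x - y‖ ^ L)⁻¹ ≤ 4 ^ k / ‖x‖ ^ k * ((1 + ‖y‖) ^ L)⁻¹ := by
  have hr : 0 < ‖x‖ := norm_pos_iff.2 hx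
  have hy' : 4 * ‖x‖ ≤ ‖y‖ := by simpa using hy
  have h1 := norm_le_norm_add_norm_sub' y x
  rw [norm_sub_rev] at h1
  have h2 : ‖y‖ - ‖x‖ ≤ ‖x - y‖ := by linarith
  have h3 := tail_comp (r1 := 3 * ‖x‖) (t := ‖x - y‖) (L := L) (by positivity) (by linarith) hL.le
  have hk1 : (1 / (3 * ‖x‖) + 1) ^ L ≤ (2/‖x‖)^k := by
    rw [← Real.rpow_natCast]
    have h4 : 1 / (3 * ‖x‖) + 1 ≤ 2 / ‖x‖ := by
      rw [div_add_one (by positivity), div_le_div_iff₀ (by positivity) hr]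
      nlinarith
    calc (1 / (3 * ‖x‖) + 1) ^ L ≤ (2/‖x‖)^L := Real.rpow_le_rpow (by positivity) h4 hL.le
      _ ≤ (2/‖x‖)^(k:ℝ) := by
        apply Real.rpow_le_rpow_of_exponent_le _ hk
        rw [le_div_iff₀ hr]; linarith
  have hk2 : ((1 + ‖x - y‖) ^ L)⁻¹ ≤ 2 ^ k * ((1 + ‖y‖) ^ L)⁻¹ := by
    rw [← div_eq_mul_inv, le_div_iff₀ (by positivity), inv_mul_le_iff₀ (by positivity)]
    calc (1 + ‖y‖)^L ≤ ((1 + ‖x-y‖) * 2)^L := by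
          apply Real.rpow_le_rpow (by positivity) _ hL.le
          linarith
      _ = (1 + ‖x-y‖)^L * 2 ^ L := Real.mul_rpow (by positivity) (by norm_num)
      _ ≤ (1 + ‖x-y‖)^L * 2 ^ k := by
          gcongr
          rw [← Real.rpow_natCast]
          exact Real.rpow_le_rpow_of_exponent_le (by norm_num) hk
  calc _ ≤ _ := h3
    _ ≤ (2/‖x‖)^k * (2 ^ k * ((1 + ‖y‖) ^ L)⁻¹) := by gcongr
    _ = _ := by
      rw [div_pow, show (4:ℝ) = 2 * 2 by norm_num, mul_pow]; ring

set_option maxHeartbeats 1000000 in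
lemma far_int {d : ℕ} {s p : ℝ} {u : Ed d → ℝ} (hs : 0 < s) (hp : 1 < p)
    (hu : memTail d s p u) (hR : Rap u) :
    ∃ r0 : ℝ, 0 < r0 ∧ (∀ x : Ed d, x ≠ 0 → ‖x‖ < r0 →
      IntegrableOn (fun y => Jp p (u x - u y) / ‖x - y‖ ^ ((d:ℝ) + s * p)) (ball 0 (4 * ‖x‖))ᶜ ∧
      IntegrableOn (fun y => Jp p (u y) / ‖x - y‖ ^ ((d:ℝ) + s * p)) (ball 0 (4 * ‖x‖))ᶜ) ∧
    Rap (fun x => (∫ y in (ball 0 (4 * ‖x‖))ᶜ, Jp p (u x - u y) / ‖x - y‖ ^ ((d:ℝ) + s * p)) +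
      ∫ y in (ball 0 (4 * ‖x‖))ᶜ, Jp p (u y) / ‖x - y‖ ^ ((d:ℝ) + s * p)) := by
  have hp1 : 0 < p - 1 := by linarith
  have hsp : 0 < s * p := by positivity
  obtain ⟨hum, ht⟩ := hu
  obtain ⟨C, q, hC, hq, hJ⟩ := jp_diff hp
  obtain ⟨A, r0, hA, hr0, hdec⟩ := hR 1
  set L := (d:ℝ) + s * p with hL
  have hL0 : 0 < L := by positivity
  obtain ⟨k, hk⟩ := exists_nat_ge L
  set W := fun y : Ed d => (1 + |u y| ^ (p-1)) / (1 + ‖y‖) ^ L with hW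
  have hWi : Integrable W := by
    have h1 : Integrable (fun y : Ed d => (1 + ‖y‖) ^ (-L)) :=
      integrable_one_add_norm (by rw [finrank_euclideanSpace_fin]; linarith)
    have h2 := h1.add ht
    refine h2.congr ?_
    filter_upwards with y
    simp only [Pi.add_apply, hW]
    rw [Real.rpow_neg (by positivity), add_div, one_div]
  have hW0 : ∀ y, 0 ≤ W y := fun y => by simp only [hW]; positivity
  have hjm := jp_meas p
  set R := min (min r0 (1/A)) (1/3) with hRd
  have hR0 : 0 < R := by positivity
  have hux1 : ∀ x : Ed d, x ≠ 0 → ‖x‖ < R → |u x| ≤ 1 := by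
    intro x hx hxR
    have h1 : ‖x‖ < 1/A := hxR.trans_le ((min_le_left _ _).trans (min_le_right _ _))
    have h2 := hdec x hx (hxR.trans_le ((min_le_left _ _).trans (min_le_left _ _)))
    rw [lt_div_iff₀ hA] at h1
    rw [pow_one] at h2
    linarith
  have hker : ∀ x : Ed d, x ≠ 0 → ‖x‖ < R → ∀ y ∈ (ball (0 : Ed d) (4 * ‖x‖))ᶜ,
     (‖x - y‖ ^ L)⁻¹ ≤ 4 ^ k / ‖x‖ ^ k * ((1 + ‖y‖) ^ L)⁻¹ := by
    intro x hx hxR y hy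
    exact far_kernel hL0 hk hx (hxR.trans_le (min_le_right _ _)).le hy
  have hsum : ∀ x : Ed d, x ≠ 0 → ‖x‖ < R → ∀ᵐ y ∂(volume.restrict (ball (0 : Ed d) (4 * ‖x‖))ᶜ),
      ‖Jp p (u x - u y) / ‖x - y‖ ^ L + Jp p (u y) / ‖x - y‖ ^ L‖ ≤ C * |u x|^q * (4^k/‖x‖^k) * W y := by
    intro x hx hxR
    rw [ae_restrict_iff' measurableSet_ball.compl]
    filter_upwards with y hy
    have h1 := hJ (u x) (u y) (hux1 x hx hxR)
    rw [← add_div, div_eq_mul_inv, norm_mul, Real.norm_eq_abs, Real.norm_eq_abs, abs_of_nonneg (by positivity : 0 ≤ (‖x - y‖ ^ L)⁻¹)]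
    calc _ ≤ C * |u x|^q * (1 + |u y|^(p-1)) * (4 ^ k / ‖x‖ ^ k * ((1 + ‖y‖) ^ L)⁻¹) :=
          mul_le_mul h1 (hker x hx hxR y hy) (by positivity) (by positivity)
      _ = _ := by simp only [hW]; ring
  have hG : ∀ x : Ed d, x ≠ 0 → ‖x‖ < R →
      IntegrableOn (fun y => Jp p (u y) / ‖x - y‖ ^ L) (ball 0 (4 * ‖x‖))ᶜ := by
    intro x hx hxR
    apply Integrable.mono' ((hWi.const_mul (4^k/‖x‖^k)).integrableOn)
    · exact Measurable.aestronglyMeasurable (by fun_prop)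
    rw [ae_restrict_iff' measurableSet_ball.compl]
    filter_upwards with y hy
    rw [div_eq_mul_inv, norm_mul, Real.norm_eq_abs, Real.norm_eq_abs, abs_of_nonneg (by positivity : 0 ≤ (‖x - y‖ ^ L)⁻¹),
      jp_abs hp]
    calc _ ≤ (1 + |u y|^(p-1)) * (4 ^ k / ‖x‖ ^ k * ((1 + ‖y‖) ^ L)⁻¹) :=
          mul_le_mul (by linarith) (hker x hx hxR y hy) (by positivity) (by positivity)
      _ = _ := by simp only [hW]; ring
  have hFG : ∀ x : Ed d, x ≠ 0 → ‖x‖ < R →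
      IntegrableOn (fun y => Jp p (u x - u y) / ‖x - y‖ ^ L + Jp p (u y) / ‖x - y‖ ^ L) (ball 0 (4 * ‖x‖))ᶜ := by
    intro x hx hxR
    apply Integrable.mono' ((hWi.const_mul _).integrableOn) _ (hsum x hx hxR)
    exact Measurable.aestronglyMeasurable (by fun_prop)
  have hF : ∀ x : Ed d, x ≠ 0 → ‖x‖ < R →
      IntegrableOn (fun y => Jp p (u x - u y) / ‖x - y‖ ^ L) (ball 0 (4 * ‖x‖))ᶜ := by
    intro x hx hxR
    refine ((hFG x hx hxR).sub (hG x hx hxR)).congr ?_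
    filter_upwards with y
    simp
  refine ⟨R, hR0, fun x hx hxR => ⟨hF x hx hxR, hG x hx hxR⟩, ?_⟩
  refine ((hR.rpow hq).div_pow k).mono (C * 4^k * ∫ y, W y) R hR0 ?_
  intro x hx hxR
  have hr : 0 < ‖x‖ := norm_pos_iff.2 hx
  rw [← integral_add (hF x hx hxR) (hG x hx hxR)]
  have hinte := hWi.const_mul (C * |u x|^q * (4^k/‖x‖^k))
  calc _ ≤ ∫ y in (ball 0 (4 * ‖x‖))ᶜ, C * |u x|^q * (4^k/‖x‖^k) * W y :=
        norm_integral_le_of_norm_le hinte.integrableOn (hsum x hx hxR)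
    _ ≤ ∫ y, C * |u x|^q * (4^k/‖x‖^k) * W y :=
        setIntegral_le_integral hinte (Eventually.of_forall fun y => mul_nonneg (by positivity) (hW0 _))
    _ = _ := by
        rw [integral_const_mul, abs_of_nonneg (by positivity : 0 ≤ |u x|^q / ‖x‖^k)]; ring

lemma pv_eq {d : ℕ} (hd : 1 ≤ d) {s p : ℝ} {u : Ed d → ℝ} {x : Ed d} {l : ℝ} (h : fracPLapAt d s p u x l)
    (hi : Integrable (fun y => Jp p (u x - u y) / ‖x - y‖ ^ ((d:ℝ) + s * p))) :
    l = ∫ y, Jp p (u x - u y) / ‖x - y‖ ^ ((d:ℝ) + s * p) := by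
  have hnt : Nontrivial (Ed d) := by
    have : Nonempty (Fin d) := ⟨⟨0, hd⟩⟩
    infer_instance
  refine tendsto_nhds_unique h ?_
  have hms : ∀ δ : ℝ, MeasurableSet {y : Ed d | δ < ‖x - y‖} := fun δ => measurableSet_lt (by fun_prop) (by fun_prop)
  simp_rw [← integral_indicator (hms _)]
  apply tendsto_integral_filter_of_dominated_convergence _ _ _ hi.norm
  · filter_upwards [Measure.ae_ne volume x] with y hy
    have hxy : 0 < ‖x - y‖ := norm_pos_iff.2 (sub_ne_zero.2 (Ne.symm hy))
    apply tendsto_const_nhds.congr'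
    filter_upwards [Ioo_mem_nhdsGT hxy] with δ hδ
    rw [indicator_of_mem]
    exact hδ.2
  · filter_upwards with δ
    exact hi.aestronglyMeasurable.indicator (hms δ)
  · filter_upwards with δ
    filter_upwards with y
    exact norm_indicator_le_norm_self _ _

lemma rap_G {d : ℕ} (hd : 1 ≤ d) {s p β r1 C : ℝ} {u : Ed d → ℝ} (hs : 0 < s) (hp : 1 < p)
    (hu : memTail d s p u)
    (hβ : s * p / (p - 1) < β) (hr1 : 0 < r1) (hC : 0 < C)
    (hH : ∀ x ∈ ball (0 : Ed d) r1, ∀ y ∈ ball (0 : Ed d) r1, |u x - u y| ≤ C * ‖x - y‖ ^ β)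
    (hD : ∀ n : ℕ, ∃ C' r0 : ℝ, 0 < C' ∧ 0 < r0 ∧ ∀ x : Ed d, ‖x‖ < r0 → |u x| ≤ C' * ‖x‖ ^ n)
    {g : Ed d → ℝ} (hg : Rap g) (hsol : ∀ x ∈ ball (0 : Ed d) r1, fracPLapAt d s p u x (g x)) :
    ∃ r0 : ℝ, 0 < r0 ∧ (∀ x : Ed d, x ≠ 0 → ‖x‖ < r0 →
      IntegrableOn (fun y => Jp p (u y) / ‖x - y‖ ^ ((d:ℝ) + s * p)) (ball 0 (4 * ‖x‖))ᶜ) ∧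
    Rap (fun x => ∫ y in (ball 0 (4 * ‖x‖))ᶜ, Jp p (u y) / ‖x - y‖ ^ ((d:ℝ) + s * p)) := by
  have hR : Rap u := by
    intro n
    obtain ⟨C', r0, h1, h2, h3⟩ := hD n
    exact ⟨C', r0, h1, h2, fun x _ hx => h3 x hx⟩
  have hnear := near_int hd hu.1 hs hp hβ hr1 hC hH hD
  have hnR : Rap (fun x : Ed d => ∫ y in ball 0 (4 * ‖x‖), Jp p (u x - u y) / ‖x - y‖ ^ ((d:ℝ) + s * p)) := by
    intro n
    obtain ⟨C', r0, h1, h2, h3⟩ := hnear n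
    exact ⟨C', r0, h1, h2, fun x h0 hx => (h3 x h0 hx).2⟩
  obtain ⟨C1, r2, hC1, hr2, hni⟩ := hnear 0
  obtain ⟨r0, hr0, hfi, hfR⟩ := far_int hs hp hu hR
  refine ⟨r0, hr0, fun x hx hxr => (hfi x hx hxr).2, ?_⟩
  have hsumR := (hfR.add hnR).add (hg.mono (g := fun x => - g x) 1 1 one_pos (fun x _ _ => by simp))
  refine hsumR.mono 1 (min (min r0 r1) r2) (by positivity) ?_
  intro x hx hxr
  have hx0 : ‖x‖ < r0 := hxr.trans_le ((min_le_left _ _).trans (min_le_left _ _))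
  have hx1 : ‖x‖ < r1 := hxr.trans_le ((min_le_left _ _).trans (min_le_right _ _))
  have hx2 : ‖x‖ < r2 := hxr.trans_le (min_le_right _ _)
  have i1 := (hni x hx hx2).1
  have i2 := (hfi x hx hx0).1
  have hi : Integrable (fun y => Jp p (u x - u y) / ‖x - y‖ ^ ((d:ℝ) + s * p)) := by
    rw [← integrableOn_univ, ← union_compl_self (ball (0 : Ed d) (4 * ‖x‖)), integrableOn_union]
    exact ⟨i1, i2⟩
  have hpv := pv_eq hd (hsol x (by rwa [mem_ball_zero_iff])) hi
  rw [← integral_add_compl measurableSet_ball hi (s := ball (0 : Ed d) (4 * ‖x‖))] at hpv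
  rw [one_mul, hpv]
  apply le_of_eq
  congr 1
  ring

/-- Kelvin-type inversion in coordinates -/
def zk {d : ℕ} (y : Ed d) : Fin d → ℝ := fun i => y i / ‖y‖ ^ 2

lemma zk_meas {d : ℕ} (q : MvPolynomial (Fin d) ℝ) : Measurable (fun y : Ed d => MvPolynomial.eval (zk y) q) := by
  have h1 : Measurable (fun y : Ed d => zk y) := by
    unfold zk
    exact measurable_pi_lambda _ (fun i => by fun_prop)
  exact (MvPolynomial.continuous_eval q).measurable.comp h1

lemma zk_le {d : ℕ} (y : Ed d) (i : Fin d) : |zk y i| ≤ ‖y‖⁻¹ := by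
  unfold zk
  rcases eq_or_ne y 0 with rfl | hy
  · simp
  · have hn : 0 < ‖y‖ := norm_pos_iff.2 hy
    have h1 := PiLp.norm_apply_le y i
    rw [Real.norm_eq_abs] at h1
    rw [abs_div, abs_of_nonneg (by positivity : 0 ≤ ‖y‖^2), div_le_iff₀ (by positivity)]
    calc |y i| ≤ ‖y‖ := h1
      _ = ‖y‖⁻¹ * ‖y‖^2 := by field_simp

lemma poly_int {d : ℕ} {μ : Ed d → ℝ} (hμ : Measurable μ)
    (In : ∀ n : ℕ, Integrable (fun y : Ed d => μ y * (‖y‖⁻¹) ^ n)) (q : MvPolynomial (Fin d) ℝ) :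
    ∀ n : ℕ, Integrable (fun y : Ed d => μ y * (‖y‖⁻¹) ^ n * MvPolynomial.eval (zk y) q) := by
  induction q using MvPolynomial.induction_on with
  | C a =>
    intro n
    simp only [MvPolynomial.eval_C]
    exact (In n).mul_const a
  | add p q hp hq =>
    intro n
    simp only [map_add, mul_add]
    exact (hp n).add (hq n)
  | mul_X q i h =>
    intro n
    refine (h (n+1)).mono ?_ ?_
    · have := zk_meas (q * MvPolynomial.X i)
      exact Measurable.aestronglyMeasurable (by fun_prop)
    · filter_upwards with y
      rw [map_mul, MvPolynomial.eval_X]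
      simp only [Real.norm_eq_abs, abs_mul, pow_succ]
      have := zk_le y i
      rw [abs_of_nonneg (by positivity : 0 ≤ ‖y‖⁻¹)]
      calc |μ y| * |‖y‖⁻¹^n| * (|(MvPolynomial.eval (zk y)) q| * |zk y i|)
          ≤ |μ y| * |‖y‖⁻¹^n| * (|(MvPolynomial.eval (zk y)) q| * ‖y‖⁻¹) := by gcongr
        _ = _ := by ring

lemma poly_int0 {d : ℕ} {μ : Ed d → ℝ} (hμ : Measurable μ)
    (In : ∀ n : ℕ, Integrable (fun y : Ed d => μ y * (‖y‖⁻¹) ^ n)) (q : MvPolynomial (Fin d) ℝ) :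
    Integrable (fun y : Ed d => μ y * MvPolynomial.eval (zk y) q) := by
  simpa using poly_int hμ In q 0

/-- the moment functional -/
def momL {d : ℕ} {μ : Ed d → ℝ} (hμ : Measurable μ)
    (In : ∀ n : ℕ, Integrable (fun y : Ed d => μ y * (‖y‖⁻¹) ^ n)) : MvPolynomial (Fin d) ℝ →ₗ[ℝ] ℝ where
  toFun q := ∫ y, μ y * MvPolynomial.eval (zk y) q
  map_add' p q := by
    simp only [map_add, mul_add]
    exact integral_add (poly_int0 hμ In p) (poly_int0 hμ In q)
  map_smul' c q := by
    simp only [MvPolynomial.smul_eval, RingHom.id_apply, smul_eq_mul]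
    rw [← integral_const_mul]
    congr 1
    ext y
    ring

lemma eval_WP {d : ℕ} (x y : Ed d) (hy : y ≠ 0) :
    1 + MvPolynomial.eval (zk y) (WP d (fun i => x i)) = (‖x - y‖ / ‖y‖) ^ 2 := by
  have hn : 0 < ‖y‖ := norm_pos_iff.2 hy
  have h1 : MvPolynomial.eval (zk y) (WP d (fun i => x i)) =
      -2 * (∑ i, x i * zk y i) + (∑ i, x i ^ 2) * ∑ i, zk y i ^ 2 := by
    simp [WP, rrP]
  have h2 : ∑ i, x i * zk y i = (∑ i, x i * y i) / ‖y‖^2 := by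
    rw [Finset.sum_div]; apply Finset.sum_congr rfl; intro i _; simp only [zk]; ring
  have hyy : ∑ i, y i ^ 2 = ‖y‖^2 := by rw [EuclideanSpace.real_norm_sq_eq]
  have hxx : ∑ i, x i ^ 2 = ‖x‖^2 := by rw [EuclideanSpace.real_norm_sq_eq]
  have h3 : ∑ i, zk y i ^ 2 = 1 / ‖y‖^2 := by
    have : ∑ i, zk y i ^ 2 = (∑ i, y i ^ 2) / (‖y‖^2)^2 := by
      rw [Finset.sum_div]; apply Finset.sum_congr rfl; intro i _; simp only [zk]; ring
    rw [this, hyy]; field_simp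
  have h4 : ‖x - y‖^2 = ‖x‖^2 - 2 * (∑ i, x i * y i) + ‖y‖^2 := by
    rw [EuclideanSpace.real_norm_sq_eq, ← hxx, ← hyy, Finset.mul_sum, ← Finset.sum_sub_distrib, ← Finset.sum_add_distrib]
    apply Finset.sum_congr rfl; intro i _; simp only [PiLp.sub_apply]; ring
  rw [h1, h2, h3, hxx, div_pow, h4]
  field_simp
  ring

lemma WP_abs {d : ℕ} (x y : Ed d) (hy : y ≠ 0) :
    |MvPolynomial.eval (zk y) (WP d (fun i => x i))| ≤ 2 * (‖x‖ * ‖y‖⁻¹) + (‖x‖ * ‖y‖⁻¹)^2 := by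
  have hn : 0 < ‖y‖ := norm_pos_iff.2 hy
  have h := eval_WP x y hy
  set w := MvPolynomial.eval (zk y) (WP d (fun i => x i))
  set τ := ‖x‖ * ‖y‖⁻¹ with hτ
  have hτ0 : 0 ≤ τ := by positivity
  set q := ‖x - y‖ / ‖y‖ with hq
  have hq1 : q ≤ 1 + τ := by
    rw [hq, div_le_iff₀ hn, hτ]
    have := norm_sub_le x y
    calc _ ≤ _ := this
      _ = _ := by field_simp; ring
  have hq2 : 1 - τ ≤ q := by
    rw [hq, le_div_iff₀ hn, hτ]
    have h1 := norm_le_norm_add_norm_sub' y x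
    rw [norm_sub_rev] at h1
    calc _ = ‖y‖ - ‖x‖ := by field_simp
      _ ≤ _ := by linarith
  have hq0 : 0 ≤ q := by positivity
  have hw : w = q^2 - 1 := by linarith
  rw [hw, abs_le]
  constructor
  · rcases le_total τ 1 with h1 | h1
    · nlinarith
    · nlinarith
  · nlinarith

set_option maxHeartbeats 1000000 in
lemma exp_bd {d : ℕ} (hd : 1 ≤ d) {L : ℝ} (hL : 0 < L) {J : Ed d → ℝ} (hJ : Measurable J)
    (hμ : Measurable (fun y : Ed d => J y / ‖y‖ ^ L))
    (In : ∀ n : ℕ, Integrable (fun y : Ed d => J y / ‖y‖ ^ L * (‖y‖⁻¹) ^ n)) (M : ℕ) :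
    ∃ C : ℝ, 0 ≤ C ∧ ∀ x : Ed d, x ≠ 0 → ‖x‖ ≤ 1 →
      IntegrableOn (fun y => J y / ‖x - y‖ ^ L) (ball 0 (4 * ‖x‖))ᶜ →
      |momL hμ In (∑ k ∈ Finset.range M, Ring.choose (-(L/2)) k • WP d (fun i => x i) ^ k)
        - ∫ y in (ball 0 (4 * ‖x‖))ᶜ, J y / ‖x - y‖ ^ L| ≤ C * ‖x‖ ^ M := by
  have hnt : Nontrivial (Ed d) := by
    have : Nonempty (Fin d) := ⟨⟨0, hd⟩⟩
    infer_instance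
  obtain ⟨C, hC, hT⟩ := taylor_bd (-(L/2)) M
  set K1 := (∑ k ∈ Finset.range M, |Ring.choose (-(L/2)) k| * 9^k) * 16^M with hK1
  have hK10 : 0 ≤ K1 := by positivity
  set K2 := C * 3^M with hK2
  have hK20 : 0 ≤ K2 := by positivity
  set I1 := ∫ y, |J y / ‖y‖ ^ L * (‖y‖⁻¹) ^ (2*M)| with hI1
  set I2 := ∫ y, |J y / ‖y‖ ^ L * (‖y‖⁻¹) ^ M| with hI2
  have hI10 : 0 ≤ I1 := integral_nonneg (fun y => abs_nonneg _)
  have hI20 : 0 ≤ I2 := integral_nonneg (fun y => abs_nonneg _)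
  refine ⟨K1 * I1 + K2 * I2, by positivity, ?_⟩
  intro x hx hx1 hG
  have hr : 0 < ‖x‖ := norm_pos_iff.2 hx
  set P := ∑ k ∈ Finset.range M, Ring.choose (-(L/2)) k • WP d (fun i => x i) ^ k with hP
  set S := (ball (0 : Ed d) (4 * ‖x‖))ᶜ with hS
  have hSm : MeasurableSet S := measurableSet_ball.compl
  have e1 : momL hμ In P = ∫ y, J y / ‖y‖ ^ L * MvPolynomial.eval (zk y) P := rfl
  rw [e1, ← integral_indicator hSm, ← integral_sub (poly_int0 hμ In P) ((integrable_indicator_iff hSm).2 hG)]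
  have hbi : Integrable (fun y : Ed d => K1 * ‖x‖^(2*M) * |J y / ‖y‖ ^ L * (‖y‖⁻¹) ^ (2*M)| +
      K2 * ‖x‖^M * |J y / ‖y‖ ^ L * (‖y‖⁻¹) ^ M|) :=
    ((In (2*M)).abs.const_mul _).add ((In M).abs.const_mul _)
  have hb : ∀ᵐ y : Ed d, ‖J y / ‖y‖ ^ L * MvPolynomial.eval (zk y) P - S.indicator (fun y => J y / ‖x - y‖ ^ L) y‖
      ≤ K1 * ‖x‖^(2*M) * |J y / ‖y‖ ^ L * (‖y‖⁻¹) ^ (2*M)| +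
      K2 * ‖x‖^M * |J y / ‖y‖ ^ L * (‖y‖⁻¹) ^ M| := by
    filter_upwards [Measure.ae_ne volume 0] with y hy
    have hn : 0 < ‖y‖ := norm_pos_iff.2 hy
    have hw := eval_WP x y hy
    have hwa := WP_abs x y hy
    have hPe : MvPolynomial.eval (zk y) P = ∑ k ∈ Finset.range M, Ring.choose (-(L/2)) k *
        (MvPolynomial.eval (zk y) (WP d (fun i => x i)))^k := by
      rw [hP, map_sum]
      apply Finset.sum_congr rfl
      intro k _
      rw [MvPolynomial.smul_eval, map_pow]
    rw [hPe]
    set w := MvPolynomial.eval (zk y) (WP d (fun i => x i))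
    set τ := ‖x‖ * ‖y‖⁻¹ with hτ
    have hτ0 : 0 < τ := by positivity
    set m := J y / ‖y‖ ^ L with hm
    have r1 : K1 * ‖x‖^(2*M) * |m * (‖y‖⁻¹) ^ (2*M)| = |m| * (K1 * τ^(2*M)) := by
      rw [abs_mul, abs_of_nonneg (by positivity : 0 ≤ ‖y‖⁻¹ ^ (2*M)), hτ, mul_pow]; ring
    have r2 : K2 * ‖x‖^M * |m * (‖y‖⁻¹) ^ M| = |m| * (K2 * τ^M) := by
      rw [abs_mul, abs_of_nonneg (by positivity : 0 ≤ ‖y‖⁻¹ ^ M), hτ, mul_pow]; ring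
    rw [r1, r2, Real.norm_eq_abs]
    by_cases hyS : y ∈ S
    · have hy4 : 4 * ‖x‖ ≤ ‖y‖ := by simpa [hS] using hyS
      have hτ4 : τ ≤ 1/4 := by
        rw [hτ, ← div_eq_mul_inv, div_le_iff₀ hn]; linarith
      have hw9 : |w| ≤ 9/16 := by nlinarith
      have hw3 : |w| ≤ 3 * τ := by nlinarith
      have hxy : 0 < ‖x - y‖ := by
        have h1 := norm_le_norm_add_norm_sub' y x
        rw [norm_sub_rev] at h1
        linarith
      rw [indicator_of_mem hyS]
      have hid : J y / ‖x - y‖ ^ L = m * (1 + w) ^ (-(L/2)) := by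
        have : (1 + w) ^ (-(L/2)) = ‖y‖^L / ‖x - y‖^L := by
          rw [hw, ← Real.rpow_natCast, ← Real.rpow_mul (by positivity),
            show ((2:ℕ):ℝ) * -(L/2) = -L by push_cast; ring, Real.rpow_neg (by positivity),
            Real.div_rpow (by positivity) (by positivity), inv_div]
        rw [this, hm]
        field_simp
      rw [hid, ← mul_sub, abs_mul, ← mul_add]
      apply mul_le_mul_of_nonneg_left _ (abs_nonneg _)
      rw [abs_sub_comm]
      calc _ ≤ C * |w|^M := hT w hw9
        _ ≤ C * (3*τ)^M := by gcongr
        _ = K2 * τ^M := by rw [hK2, mul_pow]; ring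
        _ ≤ _ := le_add_of_nonneg_left (by positivity)
    · have hy4 : ‖y‖ < 4 * ‖x‖ := by simpa [hS] using hyS
      have hτ4 : 1 ≤ 4 * τ := by
        rw [hτ, ← div_eq_mul_inv, ← mul_div_assoc, le_div_iff₀ hn]; linarith
      have hw9 : |w| ≤ 9 * τ^2 := by nlinarith
      rw [indicator_of_notMem hyS, sub_zero, abs_mul, ← mul_add]
      apply mul_le_mul_of_nonneg_left _ (abs_nonneg _)
      calc _ ≤ ∑ k ∈ Finset.range M, |Ring.choose (-(L/2)) k * w^k| := Finset.abs_sum_le_sum_abs _ _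
        _ ≤ ∑ k ∈ Finset.range M, |Ring.choose (-(L/2)) k| * 9^k * (16^M * τ^(2*M)) := by
          apply Finset.sum_le_sum
          intro k hk
          have hkM : k ≤ M := (Finset.mem_range.1 hk).le
          rw [abs_mul, abs_pow, mul_assoc]
          gcongr
          calc |w|^k ≤ (9 * τ^2)^k := by gcongr
            _ = 9^k * (τ^2)^k := by rw [mul_pow]
            _ ≤ 9^k * ((4*τ)^2)^k := by
              gcongr
              linarith
            _ ≤ 9^k * ((4*τ)^2)^M := by
              gcongr
              nlinarith
            _ = _ := by rw [mul_pow, mul_pow, pow_mul]; norm_num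
        _ = K1 * τ^(2*M) := by rw [← Finset.sum_mul, hK1]; ring
        _ ≤ _ := le_add_of_nonneg_right (by positivity)
  calc _ ≤ ∫ y : Ed d, (K1 * ‖x‖^(2*M) * |J y / ‖y‖ ^ L * (‖y‖⁻¹) ^ (2*M)| +
      K2 * ‖x‖^M * |J y / ‖y‖ ^ L * (‖y‖⁻¹) ^ M|) := norm_integral_le_of_norm_le hbi hb
    _ = K1 * ‖x‖^(2*M) * I1 + K2 * ‖x‖^M * I2 := by
      rw [integral_add ((In (2*M)).abs.const_mul _) ((In M).abs.const_mul _), integral_const_mul, integral_const_mul]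
    _ ≤ K1 * ‖x‖^M * I1 + K2 * ‖x‖^M * I2 := by
      have : ‖x‖^(2*M) ≤ ‖x‖^M := pow_le_pow_of_le_one hr.le hx1 (by omega)
      gcongr
    _ = _ := by ring

set_option maxHeartbeats 1000000 in
lemma mom_zero {d : ℕ} (hd : 1 ≤ d) {L sp : ℝ} (hsp : 0 < sp) (hL : L = d + sp) {J : Ed d → ℝ} (hJ : Measurable J)
    (hμ : Measurable (fun y : Ed d => J y / ‖y‖ ^ L))
    (In : ∀ n : ℕ, Integrable (fun y : Ed d => J y / ‖y‖ ^ L * (‖y‖⁻¹) ^ n)) {r0 : ℝ} (hr0 : 0 < r0)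
    (hG : ∀ x : Ed d, x ≠ 0 → ‖x‖ < r0 → IntegrableOn (fun y => J y / ‖x - y‖ ^ L) (ball 0 (4 * ‖x‖))ᶜ)
    (hR : Rap (fun x => ∫ y in (ball 0 (4 * ‖x‖))ᶜ, J y / ‖x - y‖ ^ L)) (m : Multiset (Fin d)) :
    momL hμ In ((m.map MvPolynomial.X).prod) = 0 := by
  have hL0 : 0 < L := by rw [hL]; positivity
  set l := momL hμ In with hl
  have key : ∀ (x : Fin d → ℝ), x ≠ 0 → ∀ M : ℕ, ∃ C t0 : ℝ, 0 < t0 ∧ ∀ t, 0 < t → t < t0 →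
      |l (∑ k ∈ Finset.range M, Ring.choose (-(L/2)) k • WP d (fun i => t * x i) ^ k)| ≤ C * t ^ M := by
    intro x hx M
    obtain ⟨C1, hC1, h1⟩ := exp_bd hd hL0 hJ hμ In M
    obtain ⟨C2, r2, hC2, hr2, h2⟩ := hR M
    set X : Ed d := WithLp.toLp 2 x with hX
    have hX0 : X ≠ 0 := by
      intro h
      apply hx
      have := congrArg (fun v : Ed d => (v : Fin d → ℝ)) h
      simpa [hX] using this
    have hXn : 0 < ‖X‖ := norm_pos_iff.2 hX0
    refine ⟨(C1 + C2) * ‖X‖^M, min (min r0 r2) 1 / ‖X‖, by positivity, ?_⟩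
    intro t ht htt
    rw [lt_div_iff₀ hXn] at htt
    have hn : ‖t • X‖ = t * ‖X‖ := by rw [norm_smul, Real.norm_eq_abs, abs_of_pos ht]
    rw [← hn] at htt
    have hne : t • X ≠ 0 := smul_ne_zero ht.ne' hX0
    have a0 : ‖t • X‖ < r0 := htt.trans_le ((min_le_left _ _).trans (min_le_left _ _))
    have a2 : ‖t • X‖ < r2 := htt.trans_le ((min_le_left _ _).trans (min_le_right _ _))
    have a1 : ‖t • X‖ < 1 := htt.trans_le (min_le_right _ _)
    have b1 := h1 (t • X) hne a1.le (hG _ hne a0)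
    have b2 := h2 (t • X) hne a2
    dsimp only at b2
    have e : (fun i => (t • X) i) = fun i => t * x i := by
      ext i; simp [hX]
    rw [e, ← hl] at b1
    rw [hn, mul_pow] at b1 b2
    have b3 := abs_sub_abs_le_abs_sub (l (∑ k ∈ Finset.range M, Ring.choose (-(L/2)) k • WP d (fun i => t * x i) ^ k))
      (∫ y in (ball 0 (4 * ‖t • X‖))ᶜ, J y / ‖t • X - y‖ ^ L)
    rw [hn] at b3
    calc _ ≤ C1 * (t^M * ‖X‖^M) + C2 * (t^M * ‖X‖^M) := by linarith
      _ = _ := by ring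
  have hl1 : l 1 = 0 := by
    obtain ⟨C, t0, ht0, h⟩ := key (fun _ => 1) (by
      intro h
      have := congrFun h ⟨0, hd⟩
      simp at this) 1
    have h' : ∀ t, 0 < t → t < t0 → |l 1| ≤ C * t := by
      intro t ht htt
      have := h t ht htt
      simpa using this
    have hlim : Tendsto (fun t : ℝ => C * t) (nhdsWithin 0 (Ioi 0)) (nhds (C * 0)) :=
      ((continuous_const.mul continuous_id).tendsto 0).mono_left nhdsWithin_le_nhds
    have := ge_of_tendsto hlim (b := |l 1|) (by
      filter_upwards [Ioo_mem_nhdsGT ht0] with t ht using h' t ht.1 ht.2)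
    rw [mul_zero] at this
    exact abs_nonpos_iff.1 this
  refine alg_main2 d l (L/2) (by positivity) (by rw [hL]; linarith) ?_ m
  intro x M
  by_cases hx : x = 0
  · refine ⟨0, 1, one_pos, ?_⟩
    intro t _ _
    have hW : WP d (fun i => t * x i) = 0 := by simp [WP, hx]
    rw [hW, map_sum, Finset.sum_eq_zero, abs_zero, zero_mul]
    intro k _
    rcases Nat.eq_zero_or_pos k with rfl | hk
    · simp [hl1]
    · rw [zero_pow hk.ne']; simp
  · exact key x hx M

/-- Step 3: all generalized moments of `J_p(u)` vanish. Under the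
hypotheses of the strong-type UCP (Hölder case) together with the Carleman condition, for
every multiindex `α ∈ ℕ^d` the function `y ↦ J_p(u(y)) |y|^{-d-sp} y^α |y|^{-2|α|}` is
integrable on `ℝ^d` and its integral vanishes. -/
theorem moments_vanish
    (d : ℕ) (hd : 1 ≤ d) (s p : ℝ) (hs : s ∈ Ioo (0 : ℝ) 1) (hp : 1 < p)
    (Ω : Set (Ed d)) (hΩ : IsOpen Ω) (h0Ω : (0 : Ed d) ∈ Ω)
    (f : Ed d → ℝ) (hf_bdd : ∃ C : ℝ, ∀ x ∈ Ω, |f x| ≤ C)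
    (hf_van : ∀ n : ℕ, f =O[nhds (0 : Ed d)] fun x => ‖x‖ ^ n)
    (V : Ed d → ℝ → ℝ) (ε₀ : ℝ) (hε₀ : 0 < ε₀) (n₀ : ℕ)
    (hV : ∃ C : ℝ, ∀ x ∈ Ω, ∀ t : ℝ, |V x t| * ‖x‖ ^ n₀ ≤ C * |t| ^ ε₀)
    (u : Ed d → ℝ) (hu : memTail d s p u)
    (β : ℝ) (hβ : s * p / (p - 1) < β) (hβ_le : β ≤ 1)
    (hreg : ∀ x ∈ Ω, ∃ r > 0, ball x r ⊆ Ω ∧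
      ∃ C : ℝ≥0, HolderOnWith C β.toNNReal u (ball x r))
    (hsol : ∀ x ∈ Ω, fracPLapAt d s p u x (f x + V x (u x)))
    (hcar : carleman d s p u) :
    ∀ α : Fin d → ℕ,
      Integrable (fun y : Ed d =>
        Jp p (u y) / ‖y‖ ^ ((d : ℝ) + s * p) * ((∏ i, y i ^ α i) / ‖y‖ ^ (2 * ∑ i, α i))) ∧
      ∫ y : Ed d,
        Jp p (u y) / ‖y‖ ^ ((d : ℝ) + s * p) * ((∏ i, y i ^ α i) / ‖y‖ ^ (2 * ∑ i, α i))
        = 0 := by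
  obtain ⟨hs0, hs1⟩ := hs
  have hp1 : 0 < p - 1 := by linarith
  have hsp : 0 < s * p := by positivity
  have hβ0 : 0 < β := lt_trans (by positivity) hβ
  obtain ⟨r1, hr1, hsub, C, hC, hH⟩ := holder_local h0Ω hβ0 hreg
  have h0b : (0 : Ed d) ∈ ball (0 : Ed d) r1 := by simpa using hr1
  have hcont : ContinuousAt u 0 := by
    have hlim : Tendsto (fun x : Ed d => C * ‖x‖ ^ β) (nhds 0) (nhds 0) := by
      have hcc : Continuous (fun x : Ed d => C * ‖x‖ ^ β) :=
        continuous_const.mul (continuous_norm.rpow_const (fun _ => Or.inr hβ0.le))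
      have := hcc.tendsto 0
      simpa [Real.zero_rpow hβ0.ne'] using this
    rw [ContinuousAt, tendsto_iff_norm_sub_tendsto_zero]
    refine squeeze_zero' (Eventually.of_forall fun _ => norm_nonneg _) ?_ hlim
    filter_upwards [ball_mem_nhds (0 : Ed d) hr1] with x hx
    have := hH x hx 0 h0b
    simpa using this
  have hu0 := u_zero hd hs0 hp hu.1 hcar hcont
  have hH0 : ∀ x ∈ ball (0 : Ed d) r1, |u x| ≤ C * ‖x‖ ^ β := by
    intro x hx
    have := hH x hx 0 h0b
    rwa [hu0, sub_zero, sub_zero] at this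
  have hz := int_zero hd hs0 hp hu hβ hr1 hC hH0
  have hIn := int_all hd hp hu.1 hcar hz
  have hD := decay hd (by positivity : 0 < (d:ℝ) + s * p) hp1 hβ0 hr1 hC hH hu0 hIn
  have hRu : Rap u := by
    intro n
    obtain ⟨C', r0, h1, h2, h3⟩ := hD n
    exact ⟨C', r0, h1, h2, fun x _ hx => h3 x hx⟩
  have hrhs := rap_rhs hΩ h0Ω hf_van hε₀ hV hRu
  obtain ⟨r0, hr0, hGi, hGR⟩ := rap_G hd hs0 hp hu hβ hr1 hC hH hD hrhs (fun x hx => hsol x (hsub hx))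
  have hjm := jp_meas p
  have hum := hu.1
  have hJm : Measurable (fun y => Jp p (u y)) := by fun_prop
  have hμ : Measurable (fun y : Ed d => Jp p (u y) / ‖y‖ ^ ((d : ℝ) + s * p)) := by fun_prop
  have In : ∀ n : ℕ, Integrable (fun y : Ed d => Jp p (u y) / ‖y‖ ^ ((d : ℝ) + s * p) * (‖y‖⁻¹) ^ n) := by
    intro n
    refine (hIn n).mono (Measurable.aestronglyMeasurable (by fun_prop)) ?_
    filter_upwards with y
    apply le_of_eq
    rw [norm_mul, norm_mul, norm_div, norm_div]
    congr 2
    rw [Real.norm_eq_abs, Real.norm_eq_abs, jp_abs hp, abs_of_nonneg (by positivity : 0 ≤ |u y| ^ (p - 1))]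
  intro α
  set m : Multiset (Fin d) := ∑ i, Multiset.replicate (α i) i with hm
  have hprod : ((m.map (MvPolynomial.X (R := ℝ))).prod) = ∏ i, MvPolynomial.X i ^ α i := by
    rw [hm, ← Multiset.coe_mapAddMonoidHom, map_sum, Multiset.prod_sum]
    simp
  have heval : ∀ y : Ed d, MvPolynomial.eval (zk y) (∏ i, MvPolynomial.X i ^ α i) =
      (∏ i, y i ^ α i) / ‖y‖ ^ (2 * ∑ i, α i) := by
    intro y
    rw [map_prod]
    simp only [map_pow, MvPolynomial.eval_X, zk, div_pow]
    rw [Finset.prod_div_distrib, pow_mul, Finset.prod_pow_eq_pow_sum]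
  have hi := poly_int0 hμ In (∏ i, MvPolynomial.X i ^ α i)
  have h0 := mom_zero hd hsp rfl hJm hμ In hr0 hGi hGR m
  rw [hprod] at h0
  simp only [heval] at hi
  refine ⟨hi, ?_⟩
  rw [← h0]
  simp only [← heval]
  rfl
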